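/- arXiv:1305.4386 — 2 statements merged into one kernel-verified Lean document; each statement's English description precedes it below -/
import Mathlib

section
/- Let G ⊂ ℂ be a bounded Jordan domain whose boundary has planar Lebesgue measure zero. Let {G_n}_{n≥1} be a sequence of bounded Jordan domains such that each ∂G_n is a smooth Jordan curve, cl(G_{n+1}) ⊂ G_n for all n, and ⋂_{n≥1} G_n = cl(G); let φ_n be a conformal (biholomorphic) map of the unit disk 𝔻 onto G_n, extended to a homeomorphism of cl(𝔻) onto cl(G_n). Suppose γ ∈ B₂¹(ℂ∖cl(G)) is such that each boundary function θ ↦ γ(φ_n(e^{iθ})) is integrable and sup_{n≥1} ρ(γ∘φ_n(e^{iθ})) < ∞. Then there exists g ∈ B₂(G) such that γ(ζ) = (1/π)∬_G conj(g(z))/(z−ζ) dx dy for all ζ ∈ ℂ∖cl(G), i.e., γ lies in the range of the Cauchy transform K on B₂(G). -/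
open Complex MeasureTheory Metric Set Filter Bornology

/-- A Jordan curve: the image of an injective continuous map of the unit circle into `ℂ`. -/
def IsJordanCurve (J : Set ℂ) : Prop :=
  ∃ f : ℂ → ℂ, ContinuousOn f (Metric.sphere 0 1) ∧
    Set.InjOn f (Metric.sphere 0 1) ∧ J = f '' Metric.sphere 0 1

/-- A Jordan domain: a bounded connected component of the complement of a Jordan curve. -/
def IsJordanDomain (G : Set ℂ) : Prop :=
  ∃ J : Set ℂ, IsJordanCurve J ∧ Bornology.IsBounded G ∧
    ∃ z ∈ Jᶜ, G = connectedComponentIn Jᶜ z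

/-- A smooth Jordan curve: admits a `C¹` periodic parametrization, injective on a period,
with nonvanishing derivative. -/
def IsSmoothJordanCurve (J : Set ℂ) : Prop :=
  ∃ p : ℝ → ℂ, ContDiff ℝ 1 p ∧ (∀ θ : ℝ, p (θ + 2 * Real.pi) = p θ) ∧
    Set.InjOn p (Set.Ico 0 (2 * Real.pi)) ∧ (∀ θ : ℝ, deriv p θ ≠ 0) ∧
    J = Set.range p

/-- Membership in the Bergman space `B₂(G)`: holomorphic with square-integrable modulus. -/
def MemB2 (G : Set ℂ) (g : ℂ → ℂ) : Prop :=
  DifferentiableOn ℂ g G ∧ IntegrableOn (fun z => ‖g z‖ ^ 2) G volume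

/-- The Cauchy transform `(Kg)(ζ) = (1/π) ∬_G conj (g z) / (z - ζ) dx dy`. -/
noncomputable def cauchyTransform (G : Set ℂ) (g : ℂ → ℂ) (ζ : ℂ) : ℂ :=
  (1 / Real.pi : ℂ) * ∫ z in G, (starRingEnd ℂ) (g z) / (z - ζ) ∂volume

/-- The `k`-th Fourier coefficient of the boundary function `θ ↦ f (e^{iθ})`. -/
noncomputable def fourierCoef (f : ℂ → ℂ) (k : ℤ) : ℂ :=
  (1 / (2 * Real.pi)) * ∫ θ in (0:ℝ)..(2 * Real.pi),
    f (Complex.exp (θ * Complex.I)) * Complex.exp (-(Complex.I * (k : ℂ) * (θ : ℂ)))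

/-- Membership in `B₂¹(Ω)`: holomorphic, vanishing at infinity, with square-integrable
derivative on `Ω`. -/
def MemB21 (Ω : Set ℂ) (γ : ℂ → ℂ) : Prop :=
  DifferentiableOn ℂ γ Ω ∧ Tendsto γ (cobounded ℂ) (nhds 0) ∧
    IntegrableOn (fun ζ => ‖deriv γ ζ‖ ^ 2) Ω volume

theorem integral_ball_eq_polar {f : ℂ → ℂ} {R : ℝ} (hf : ContinuousOn f (closedBall 0 R)) :
    ∫ w in ball 0 R, f w =
      ∫ r in Ioo 0 R, (r : ℂ) * ∫ θ in Ioo (-Real.pi) Real.pi, f (circleMap 0 r θ) := by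
  have hsymm : ∀ p : ℝ × ℝ, Complex.polarCoord.symm p = circleMap 0 p.1 p.2 := by
    intro p
    rw [Complex.polarCoord_symm_apply, circleMap, Complex.exp_mul_I]
    push_cast
    ring
  rw [← integral_indicator measurableSet_ball, ← Complex.integral_comp_polarCoord_symm,
    polarCoord_target]
  have hset : ∫ p in Ioi (0 : ℝ) ×ˢ Ioo (-Real.pi) Real.pi,
        p.1 • (ball 0 R).indicator f (Complex.polarCoord.symm p)
      = ∫ p in Ioo (0 : ℝ) R ×ˢ Ioo (-Real.pi) Real.pi, (p.1 : ℂ) * f (circleMap 0 p.1 p.2) := by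
    rw [← integral_indicator (measurableSet_Ioi.prod measurableSet_Ioo),
      ← integral_indicator (measurableSet_Ioo.prod measurableSet_Ioo)]
    congr 1
    ext p
    simp only [indicator, mem_prod, mem_Ioi, hsymm, mem_ball_zero_iff, norm_circleMap_zero,
      Set.mem_Ioo (a := (0 : ℝ))]
    split_ifs with h1 h2 h3 h3 h3 <;> grind [abs_of_pos, Complex.real_smul]
  rw [hset, Measure.volume_eq_prod, setIntegral_prod]
  · simp only [integral_const_mul]
  · have hK : IsCompact (Icc (0 : ℝ) R ×ˢ Icc (-Real.pi) Real.pi) :=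
      isCompact_Icc.prod isCompact_Icc
    refine IntegrableOn.mono_set (ContinuousOn.integrableOn_compact hK ?_)
      (prod_mono Ioo_subset_Icc_self Ioo_subset_Icc_self)
    refine ContinuousOn.mul (by fun_prop) (hf.comp ?_ ?_)
    · simp only [circleMap]
      fun_prop
    · rintro p ⟨h1, -⟩
      simpa [abs_of_nonneg h1.1] using h1.2

theorem integral_ball_conj_pow_mul {B : ℂ → ℂ} {R : ℝ} (hR : 0 ≤ R)
    (hB : ContinuousOn B (closedBall 0 R)) (m : ℕ) (b : ℂ)
    (hb : ∀ r ∈ Ioo 0 R, ∮ w in C(0, r), B w / w ^ (m + 1) = 2 * Real.pi * I * b) :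
    ∫ w in ball 0 R, (starRingEnd ℂ) w ^ m * B w =
      Real.pi * R ^ (2 * m + 2) / (m + 1) * b := by
  rw [integral_ball_eq_polar (f := fun w => (starRingEnd ℂ) w ^ m * B w)
    (((Complex.continuous_conj.pow m).continuousOn).mul hB)]
  have hin : ∀ r ∈ Ioo 0 R, (r : ℂ) * ∫ θ in Ioo (-Real.pi) Real.pi,
      (starRingEnd ℂ) (circleMap 0 r θ) ^ m * B (circleMap 0 r θ)
      = (2 * Real.pi * b) * (r : ℂ) ^ (2 * m + 1) := by
    intro r hr
    have hr0 : (r : ℂ) ≠ 0 := by exact_mod_cast hr.1.ne'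
    have hpt : ∀ θ : ℝ, (starRingEnd ℂ) (circleMap 0 r θ) ^ m * B (circleMap 0 r θ)
        = (r : ℂ) ^ (2 * m) * I⁻¹ * (deriv (circleMap 0 r) θ •
          (B (circleMap 0 r θ) / (circleMap 0 r θ) ^ (m + 1))) := by
      intro θ
      have hne : circleMap 0 r θ ≠ 0 := by simpa using hr.1.ne'
      have hc : (starRingEnd ℂ) (circleMap 0 r θ) * circleMap 0 r θ = (r : ℂ) ^ 2 := by
        rw [Complex.conj_mul', norm_circleMap_zero]
        norm_cast
        simp
      rw [pow_mul, ← hc, mul_pow, deriv_circleMap, smul_eq_mul]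
      field_simp
      ring
    have hper : ∫ θ in (-Real.pi)..Real.pi, deriv (circleMap 0 r) θ •
          (B (circleMap 0 r θ) / (circleMap 0 r θ) ^ (m + 1)) = 2 * Real.pi * I * b := by
      rw [← hb r hr, circleIntegral]
      have := Function.Periodic.intervalIntegral_add_eq (f := fun θ => deriv (circleMap 0 r) θ •
          (B (circleMap 0 r θ) / (circleMap 0 r θ) ^ (m + 1))) (T := 2 * Real.pi) ?_ (-Real.pi) 0
      · rwa [zero_add, show -Real.pi + 2 * Real.pi = Real.pi by ring] at this
      · intro θ
        simp only [deriv_circleMap, periodic_circleMap 0 r θ]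
    rw [← integral_Ioc_eq_integral_Ioo, ← intervalIntegral.integral_of_le (by linarith [Real.pi_pos])]
    simp only [hpt]
    rw [intervalIntegral.integral_const_mul, hper]
    have := I_ne_zero
    field_simp
    ring
  rw [setIntegral_congr_fun measurableSet_Ioo hin, integral_const_mul,
    ← integral_Ioc_eq_integral_Ioo, ← intervalIntegral.integral_of_le hR]
  have : ∫ r in (0:ℝ)..R, (r : ℂ) ^ (2 * m + 1) = ((R ^ (2 * m + 2) / (2 * m + 2) : ℝ) : ℂ) := by
    have h : ∀ r : ℝ, (r : ℂ) ^ (2 * m + 1) = ((r ^ (2 * m + 1) : ℝ) : ℂ) := by simp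
    simp only [h]
    rw [intervalIntegral.integral_ofReal, integral_pow]
    congr 1
    push_cast
    ring
  rw [this]
  push_cast
  have : (m : ℂ) + 1 ≠ 0 := by exact_mod_cast (Nat.succ_ne_zero m)
  have h2 : 2 * (m : ℂ) + 2 ≠ 0 := by exact_mod_cast (Nat.succ_ne_zero (2 * m + 1))
  field_simp

theorem norm_integral_mul_le_sqrt_mul_sqrt {α : Type*} [MeasurableSpace α] {μ : Measure α}
    {f g : α → ℂ} (hf : MemLp f 2 μ) (hg : MemLp g 2 μ) :
    ‖∫ x, f x * g x ∂μ‖ ≤ √(∫ x, ‖f x‖ ^ 2 ∂μ) * √(∫ x, ‖g x‖ ^ 2 ∂μ) := by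
  refine (norm_integral_le_integral_norm _).trans ?_
  have h := integral_mul_norm_le_Lp_mul_Lq (μ := μ) (f := f) (g := g)
    (p := 2) (q := 2) (by norm_num [Real.holderConjugate_iff]) (by simpa using hf) (by simpa using hg)
  simpa [Real.sqrt_eq_rpow] using h

theorem circleIntegral_sum_pow_div {r : ℝ} (hr : 0 < r) (c : ℕ → ℂ) (N m : ℕ) :
    ∮ w in C(0, r), (∑ k ∈ Finset.range N, c k * w ^ k) / w ^ (m + 1) =
      2 * Real.pi * I * if m < N then c m else 0 := by
  have hmono : ∀ k : ℕ, ∮ w in C(0, r), w ^ k / w ^ (m + 1) =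
      if k = m then 2 * Real.pi * I else 0 := by
    intro k
    have hz : EqOn (fun w : ℂ => w ^ k / w ^ (m + 1))
        (fun w => (w - 0) ^ ((k : ℤ) - (m + 1 : ℕ))) (sphere 0 r) := by
      intro w hw
      have hw0 : w ≠ 0 := by
        rintro rfl
        simp at hw
        exact hr.ne hw
      simp [zpow_sub₀ hw0, -Nat.cast_add]
      norm_cast
    rw [circleIntegral.integral_congr hr.le hz]
    split_ifs with h
    · subst h
      have := circleIntegral.integral_sub_center_inv (0 : ℂ) hr.ne'
      rw [← this]
      congr 1
      ext w
      rw [← zpow_neg_one]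
      congr 1
      push_cast
      ring
    · exact circleIntegral.integral_sub_zpow_of_ne (by push_cast; omega) _ _ _
  have hci : ∀ k : ℕ, CircleIntegrable (fun w : ℂ => c k * (w ^ k / w ^ (m + 1))) 0 r := by
    intro k
    refine ContinuousOn.circleIntegrable hr.le ?_
    refine continuousOn_const.mul (ContinuousOn.div (by fun_prop) (by fun_prop) ?_)
    intro w hw
    refine pow_ne_zero _ ?_
    rintro rfl
    simp at hw
    exact hr.ne hw
  have : (fun w : ℂ => (∑ k ∈ Finset.range N, c k * w ^ k) / w ^ (m + 1)) =
      fun w => ∑ k ∈ Finset.range N, c k * (w ^ k / w ^ (m + 1)) := by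
    ext w
    rw [Finset.sum_div]
    simp only [mul_div_assoc]
  rw [this, circleIntegral.integral_fun_sum fun k _ => hci k]
  simp only [circleIntegral.integral_const_mul, hmono]
  simp [mul_comm]

theorem norm_sum_mul_coeff_le {B : ℂ → ℂ} {R : ℝ} (hR : 0 ≤ R)
    (hB : ContinuousOn B (closedBall 0 R)) (b : ℕ → ℂ)
    (hb : ∀ m, ∀ r ∈ Ioo 0 R, ∮ w in C(0, r), B w / w ^ (m + 1) = 2 * Real.pi * I * b m)
    (a : ℕ → ℂ) (N : ℕ) :
    Real.pi * ‖∑ m ∈ Finset.range N, a m * b m * R ^ (2 * m + 2)‖ ≤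
      √(Real.pi * ∑ m ∈ Finset.range N, (m + 1) * ‖a m‖ ^ 2 * R ^ (2 * m + 2)) *
        √(∫ w in ball 0 R, ‖B w‖ ^ 2) := by
  set P : ℂ → ℂ := fun w => ∑ k ∈ Finset.range N, ((k + 1) * (starRingEnd ℂ) (a k)) * w ^ k with hP
  have hPc : Continuous P := by fun_prop
  have key : ∀ (D : ℂ → ℂ) (d : ℕ → ℂ), ContinuousOn D (closedBall 0 R) →
      (∀ m < N, ∀ r ∈ Ioo 0 R, ∮ w in C(0, r), D w / w ^ (m + 1) = 2 * Real.pi * I * d m) →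
      ∫ w in ball 0 R, (starRingEnd ℂ) (P w) * D w =
        Real.pi * ∑ m ∈ Finset.range N, a m * d m * R ^ (2 * m + 2) := by
    intro D d hD hd
    have h1 : ∀ w, (starRingEnd ℂ) (P w) * D w = ∑ k ∈ Finset.range N,
        ((k + 1) * a k) * ((starRingEnd ℂ) w ^ k * D w) := by
      intro w
      simp only [hP, map_sum, map_mul, map_pow, Finset.sum_mul, map_add, map_natCast, map_one,
        Complex.conj_conj, mul_assoc]
    simp only [h1]
    rw [integral_finsetSum, Finset.mul_sum]
    · refine Finset.sum_congr rfl fun k hk => ?_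
      rw [integral_const_mul, integral_ball_conj_pow_mul hR hD k (d k)
        (hd k (Finset.mem_range.1 hk))]
      have : (k : ℂ) + 1 ≠ 0 := by exact_mod_cast (Nat.succ_ne_zero k)
      field_simp
    · intro k _
      refine IntegrableOn.mono_set (ContinuousOn.integrableOn_compact
        (isCompact_closedBall (0 : ℂ) R) ?_) ball_subset_closedBall
      exact continuousOn_const.mul (((Complex.continuous_conj.pow k).continuousOn).mul hD)
  have hPP : ∫ w in ball 0 R, ‖P w‖ ^ 2 =
      Real.pi * ∑ m ∈ Finset.range N, (m + 1) * ‖a m‖ ^ 2 * R ^ (2 * m + 2) := by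
    have h := key P (fun k => (k + 1) * (starRingEnd ℂ) (a k)) hPc.continuousOn ?_
    · have h2 : ∀ w, (starRingEnd ℂ) (P w) * P w = ((‖P w‖ ^ 2 : ℝ) : ℂ) := by
        intro w
        rw [Complex.conj_mul']
        push_cast
        rfl
      simp only [h2] at h
      rw [integral_complex_ofReal] at h
      apply Complex.ofReal_injective
      refine h.trans ?_
      push_cast
      congr 1
      refine Finset.sum_congr rfl fun k _ => ?_
      rw [← Complex.mul_conj']
      ring
    · intro m hm r hr
      rw [circleIntegral_sum_pow_div hr.1, if_pos hm]
  have hmem : ∀ D : ℂ → ℂ, ContinuousOn D (closedBall 0 R) →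
      MemLp D 2 (volume.restrict (ball 0 R)) := by
    intro D hD
    have hm : AEStronglyMeasurable D (volume.restrict (ball 0 R)) :=
      (hD.mono ball_subset_closedBall).aestronglyMeasurable measurableSet_ball
    rw [memLp_two_iff_integrable_sq_norm hm]
    exact IntegrableOn.mono_set (ContinuousOn.integrableOn_compact
        (isCompact_closedBall (0 : ℂ) R) (hD.norm.pow 2)) ball_subset_closedBall
  have hfin := norm_integral_mul_le_sqrt_mul_sqrt
    (hmem (fun w => (starRingEnd ℂ) (P w)) (Complex.continuous_conj.comp hPc).continuousOn)
    (hmem B hB)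
  rw [key B b hB fun m _ => hb m, norm_mul, Complex.norm_real, Real.norm_of_nonneg Real.pi_pos.le]
    at hfin
  simpa only [RCLike.norm_conj, hPP] using hfin

theorem hasSum_circleIntegral_mul {F B : ℂ → ℂ} {r : ℝ} (hr : 0 < r)
    (hF : ContinuousOn F (sphere 0 r)) {b : ℕ → ℂ}
    (hsum : ∀ w ∈ closedBall (0 : ℂ) r, HasSum (fun m => b m * w ^ m) (B w)) :
    HasSum (fun m : ℕ => b m * ∮ w in C(0, r), F w * w ^ m) (∮ w in C(0, r), F w * B w) := by
  obtain ⟨M, hM⟩ := (isCompact_sphere (0 : ℂ) r).exists_bound_of_continuousOn hF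
  have hFc : Continuous fun θ : ℝ => F (circleMap 0 r θ) :=
    hF.comp_continuous (continuous_circleMap 0 r) fun θ => circleMap_mem_sphere 0 hr.le θ
  simp only [circleIntegral, ← intervalIntegral.integral_const_mul]
  have hrb : Summable fun m => ‖b m‖ * r ^ m := by
    have := (hsum r (by simp [abs_of_pos hr])).summable.norm
    simpa [abs_of_pos hr] using this
  refine intervalIntegral.hasSum_integral_of_dominated_convergence
    (fun m _ => r * M * (‖b m‖ * r ^ m)) ?_ ?_ ?_ ?_ ?_
  · intro m
    refine Continuous.aestronglyMeasurable ?_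
    have hcm : Continuous (circleMap 0 r) := continuous_circleMap 0 r
    simp only [deriv_circleMap, smul_eq_mul]
    exact continuous_const.mul ((hcm.mul continuous_const).mul (hFc.mul (hcm.pow m)))
  · intro m
    refine Eventually.of_forall fun θ _ => ?_
    have h1 := hM _ (circleMap_mem_sphere 0 hr.le θ)
    simp only [deriv_circleMap, norm_mul, norm_smul, norm_pow, norm_circleMap_zero, norm_I,
      abs_of_pos hr, mul_one]
    calc ‖b m‖ * (r * (‖F (circleMap 0 r θ)‖ * r ^ m))
        = (r * (‖b m‖ * r ^ m)) * ‖F (circleMap 0 r θ)‖ := by ring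
      _ ≤ (r * (‖b m‖ * r ^ m)) * M := by gcongr
      _ = r * M * (‖b m‖ * r ^ m) := by ring
  · exact Eventually.of_forall fun θ _ => hrb.mul_left _
  · exact intervalIntegrable_const
  · refine Eventually.of_forall fun θ _ => ?_
    have h := hsum (circleMap 0 r θ) (by simp [abs_of_pos hr])
    rw [smul_eq_mul, ← mul_assoc]
    refine (h.mul_left (deriv (circleMap 0 r) θ * F (circleMap 0 r θ))).congr_fun fun m => ?_
    simp only [smul_eq_mul]
    ring

theorem norm_circleIntegral_mul_le {F B : ℂ → ℂ} {r : ℝ} (hr : 0 < r) (hr1 : r < 1)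
    (hF : ContinuousOn F (sphere 0 r)) (hB : DifferentiableOn ℂ B (ball 0 1))
    (hB2 : IntegrableOn (fun w => ‖B w‖ ^ 2) (ball 0 1)) {a : ℕ → ℂ}
    (ha : ∀ m : ℕ, ∮ w in C(0, r), F w * w ^ m = 2 * Real.pi * I * a m)
    (hs : Summable fun m : ℕ => ((m : ℝ) + 1) * ‖a m‖ ^ 2) {C : ℝ}
    (hC : Real.pi * ∑' m : ℕ, ((m : ℝ) + 1) * ‖a m‖ ^ 2 ≤ C) :
    ‖∮ w in C(0, r), F w * B w‖ ≤ 2 * (√C * √(∫ w in ball 0 1, ‖B w‖ ^ 2)) := by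
  set b : ℕ → ℂ := fun m => (m.factorial : ℂ)⁻¹ * iteratedDeriv m B 0 with hb
  have hpartial : ∀ N : ℕ, Real.pi * ‖∑ m ∈ Finset.range N, a m * b m‖ ≤
      √C * √(∫ w in ball 0 1, ‖B w‖ ^ 2) := by
    intro N
    have hlim : Tendsto (fun R : ℝ => Real.pi * ‖∑ m ∈ Finset.range N, a m * b m * R ^ (2 * m + 2)‖)
        (nhdsWithin 1 (Iio 1)) (nhds (Real.pi * ‖∑ m ∈ Finset.range N, a m * b m‖)) := by
      have hc : Continuous fun R : ℝ =>
          Real.pi * ‖∑ m ∈ Finset.range N, a m * b m * (R : ℂ) ^ (2 * m + 2)‖ := by fun_prop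
      have := (hc.tendsto 1).mono_left (nhdsWithin_le_nhds (s := Iio (1 : ℝ)))
      simpa using this
    refine le_of_tendsto hlim ?_
    filter_upwards [Ioo_mem_nhdsLT (show (0 : ℝ) < 1 by norm_num)] with R hR
    refine (norm_sum_mul_coeff_le hR.1.le ((hB.mono (closedBall_subset_ball hR.2)).continuousOn)
      b ?_ a N).trans ?_
    · intro m s hs
      have := (hB.mono (closedBall_subset_ball
        (hs.2.trans hR.2))).circleIntegral_one_div_sub_center_pow_smul hs.1 m
      simp only [sub_zero, smul_eq_mul] at this
      simp only [div_eq_mul_inv, one_mul] at this ⊢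
      simp only [hb]
      simp only [mul_comm (B _), this]
      ring
    · gcongr
      · refine le_trans ?_ hC
        gcongr
        refine le_trans (Finset.sum_le_sum fun m _ => ?_)
          (hs.sum_le_tsum (Finset.range N) fun m _ => by positivity)
        exact mul_le_of_le_one_right (by positivity) (pow_le_one₀ hR.1.le hR.2.le)
      · exact Eventually.of_forall fun w => by positivity
      · exact hR.2.le
  have hsum : ∀ w ∈ closedBall (0 : ℂ) r, HasSum (fun m => b m * w ^ m) (B w) := by
    intro w hw
    have h := Complex.hasSum_taylorSeries_on_ball hB (closedBall_subset_ball hr1 hw)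
    refine h.congr_fun ?_
    intro m
    simp only [hb, sub_zero, smul_eq_mul]
    ring
  have hlim := ((hasSum_circleIntegral_mul hr hF hsum).tendsto_sum_nat).norm
  refine le_of_tendsto' hlim fun N => ?_
  have : ∑ m ∈ Finset.range N, b m *
      ∮ w in C(0, r), F w * w ^ m = 2 * Real.pi * I * ∑ m ∈ Finset.range N, a m * b m := by
    rw [Finset.mul_sum]
    refine Finset.sum_congr rfl fun m _ => ?_
    rw [ha]
    ring
  rw [this]
  have h := hpartial N
  simp only [norm_mul, norm_I, Complex.norm_real, Real.norm_of_nonneg Real.pi_pos.le,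
    Complex.norm_ofNat, mul_one]
  linarith

theorem nhds_le_map_nhds_of_injOn {f : ℂ → ℂ} {U : Set ℂ} (hU : IsOpen U)
    (hf : DifferentiableOn ℂ f U) (hinj : InjOn f U) {z : ℂ} (hz : z ∈ U) :
    nhds (f z) ≤ Filter.map f (nhds z) := by
  refine (hf.analyticAt (hU.mem_nhds hz)).eventually_constant_or_nhds_le_map_nhds.resolve_left
    fun h => ?_
  have h1 : ∀ᶠ w in nhdsWithin z {z}ᶜ, False := by
    filter_upwards [nhdsWithin_le_nhds h, nhdsWithin_le_nhds (hU.mem_nhds hz),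
      self_mem_nhdsWithin] with w h2 h3 h4
    exact h4 (hinj h3 hz h2)
  exact h1.exists.elim fun _ h => h

theorem isOpen_image_of_injOn {f : ℂ → ℂ} {U : Set ℂ} (hU : IsOpen U)
    (hf : DifferentiableOn ℂ f U) (hinj : InjOn f U) : IsOpen (f '' U) := by
  rw [isOpen_iff_mem_nhds]
  rintro _ ⟨z, hz, rfl⟩
  exact nhds_le_map_nhds_of_injOn hU hf hinj hz (image_mem_map (hU.mem_nhds hz))

theorem deriv_ne_zero_of_injOn {f : ℂ → ℂ} {U : Set ℂ} (hU : IsOpen U)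
    (hf : DifferentiableOn ℂ f U) (hinj : InjOn f U) {z : ℂ} (hz : z ∈ U) : deriv f z ≠ 0 := by
  set ψ : ℂ → ℂ := Function.invFunOn f U
  have hleft : ∀ w ∈ U, ψ (f w) = w := fun w hw => hinj.leftInvOn_invFunOn hw
  have hcont : ∀ w ∈ U, ContinuousAt ψ (f w) := by
    intro w hw
    rw [ContinuousAt, hleft w hw]
    refine (tendsto_map'_iff.2 ?_).mono_left (nhds_le_map_nhds_of_injOn hU hf hinj hw)
    refine tendsto_id.congr' ?_
    filter_upwards [hU.mem_nhds hw] with x hx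
    exact (hleft x hx).symm
  have hdiff : ∀ w ∈ U, deriv f w ≠ 0 → DifferentiableAt ℂ ψ (f w) := by
    intro w hw hne
    refine (HasDerivAt.of_local_left_inverse (f := f) (f' := deriv f w) (hcont w hw) ?_ hne
      (nhds_le_map_nhds_of_injOn hU hf hinj hw ?_)).differentiableAt
    · rw [hleft w hw]
      exact (hf.differentiableAt (hU.mem_nhds hw)).hasDerivAt
    · refine mem_map.2 ?_
      filter_upwards [hU.mem_nhds hw] with x hx
      simp [hleft x hx]
  have hψ : DifferentiableAt ℂ ψ (f z) := by
    rcases ((hf.analyticAt (hU.mem_nhds hz)).deriv).eventually_eq_zero_or_eventually_ne_zero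
      with h | h
    · exfalso
      obtain ⟨ε, hε, hb⟩ := Metric.eventually_nhds_iff_ball.1 (h.and (hU.mem_nhds hz))
      have hw : z + (ε / 2 : ℝ) ∈ ball z ε := by
        simp [abs_of_pos hε, hε]
      have := (convex_ball z ε).is_const_of_fderivWithin_eq_zero (𝕜 := ℂ) (f := f)
        (hf.mono fun x hx => (hb x hx).2) (fun x hx => ?_) hw (mem_ball_self hε)
      · have := hinj (hb _ hw).2 hz this
        simp [hε.ne'] at this
      · rw [fderivWithin_of_isOpen isOpen_ball hx]
        ext
        simpa using (hb x hx).1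
    · refine (Complex.analyticAt_of_differentiable_on_punctured_nhds_of_continuousAt ?_
        (hcont z hz)).differentiableAt
      rw [eventually_nhdsWithin_iff] at h ⊢
      refine nhds_le_map_nhds_of_injOn hU hf hinj hz ?_
      refine mem_map.2 ?_
      filter_upwards [h, hU.mem_nhds hz] with w h1 h2 h3
      exact hdiff w h2 (h1 fun hwz => h3 (by rw [mem_singleton_iff.1 hwz]; rfl))
  have hcomp := hψ.hasDerivAt.comp z (hf.differentiableAt (hU.mem_nhds hz)).hasDerivAt
  have hid : HasDerivAt (ψ ∘ f) 1 z := by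
    refine (hasDerivAt_id z).congr_of_eventuallyEq ?_
    filter_upwards [hU.mem_nhds hz] with x hx
    exact hleft x hx
  intro h0
  have := hcomp.unique hid
  simp [h0] at this

theorem differentiableAt_integral_div_sub {u p : ℝ → ℂ} (hu : Continuous u) (hp : Continuous p)
    {a b : ℝ} {ζ : ℂ} (hζ : ζ ∉ p '' uIcc a b) :
    DifferentiableAt ℂ (fun ζ => ∫ θ in a..b, u θ / (p θ - ζ)) ζ := by
  have hcl : IsClosed (p '' uIcc a b) := (isCompact_uIcc.image hp).isClosed
  obtain ⟨ε, hε, hb⟩ := Metric.isOpen_iff.1 hcl.isOpen_compl ζ hζ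
  obtain ⟨M, hM⟩ := (isCompact_uIcc (a := a) (b := b)).exists_bound_of_continuousOn hu.continuousOn
  have hdist : ∀ θ ∈ uIcc a b, ∀ x ∈ ball ζ (ε / 2), ε / 2 ≤ ‖p θ - x‖ := by
    intro θ hθ x hx
    have h1 : p θ ∉ ball ζ ε := fun h => hb h (mem_image_of_mem p hθ)
    rw [mem_ball, not_lt, dist_eq_norm] at h1
    rw [mem_ball, dist_eq_norm] at hx
    have := norm_add_le (p θ - x) (x - ζ)
    rw [sub_add_sub_cancel] at this
    linarith
  have hne : ∀ θ ∈ uIcc a b, ∀ x ∈ ball ζ (ε / 2), p θ - x ≠ 0 := by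
    intro θ hθ x hx h
    have := hdist θ hθ x hx
    rw [h, norm_zero] at this
    linarith
  have hζb : ζ ∈ ball ζ (ε / 2) := mem_ball_self (by positivity)
  have hcont : ∀ x ∈ ball ζ (ε / 2), ∀ n : ℕ, ContinuousOn (fun θ => u θ / (p θ - x) ^ n) (uIcc a b) :=
    fun x hx n => hu.continuousOn.div (by fun_prop) fun θ hθ => pow_ne_zero n (hne θ hθ x hx)
  refine (intervalIntegral.hasDerivAt_integral_of_dominated_loc_of_deriv_le
    (F := fun ζ θ => u θ / (p θ - ζ)) (F' := fun ζ θ => u θ / (p θ - ζ) ^ 2)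
    (bound := fun _ => M / (ε / 2) ^ 2) (isOpen_ball.mem_nhds hζb) ?_ ?_ ?_ ?_
    intervalIntegrable_const ?_).2.differentiableAt
  · filter_upwards [isOpen_ball.mem_nhds hζb] with x hx
    refine (ContinuousOn.aestronglyMeasurable ?_ measurableSet_uIoc)
    simpa using (hcont x hx 1).mono uIoc_subset_uIcc
  · simpa using (hcont ζ hζb 1).intervalIntegrable
  · exact ((hcont ζ hζb 2).mono uIoc_subset_uIcc).aestronglyMeasurable measurableSet_uIoc
  · refine Eventually.of_forall fun θ hθ x hx => ?_
    have hθ' := uIoc_subset_uIcc hθ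
    rw [norm_div, norm_pow]
    have h1 := hM θ hθ'
    have h2 := hdist θ hθ' x hx
    have h3 : 0 ≤ M := (norm_nonneg _).trans h1
    gcongr
  · refine Eventually.of_forall fun θ hθ x hx => ?_
    have h0 := hne θ (uIoc_subset_uIcc hθ) x hx
    exact ((hasDerivAt_const x (u θ)).div ((hasDerivAt_id x).const_sub (p θ)) h0).congr_deriv
      (by simp)

theorem tendsto_integral_div_sub_cobounded {u p : ℝ → ℂ} (hu : Continuous u) (hp : Continuous p)
    (a b : ℝ) :
    Tendsto (fun ζ => ∫ θ in a..b, u θ / (p θ - ζ)) (cobounded ℂ) (nhds 0) := by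
  obtain ⟨M, hM⟩ := (isCompact_uIcc (a := a) (b := b)).exists_bound_of_continuousOn hu.continuousOn
  obtain ⟨P, hP⟩ := (isCompact_uIcc (a := a) (b := b)).exists_bound_of_continuousOn hp.continuousOn
  have hlim : Tendsto (fun ζ : ℂ => M / (‖ζ‖ - P) * |b - a|) (cobounded ℂ) (nhds 0) := by
    have h1 : Tendsto (fun ζ : ℂ => ‖ζ‖ - P) (cobounded ℂ) atTop :=
      tendsto_atTop_add_const_right _ (-P) tendsto_norm_cobounded_atTop
    simpa using (h1.const_div_atTop M).mul_const |b - a|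
  refine squeeze_zero_norm' ?_ hlim
  filter_upwards [tendsto_norm_cobounded_atTop.eventually_gt_atTop P] with ζ hζ
  refine intervalIntegral.norm_integral_le_of_norm_le_const fun θ hθ => ?_
  have hθ' := uIoc_subset_uIcc hθ
  have h1 := hM θ hθ'
  have h2 := hP θ hθ'
  have h3 : 0 ≤ M := (norm_nonneg _).trans h1
  have h4 : ‖ζ‖ - P ≤ ‖p θ - ζ‖ := by
    have := norm_sub_norm_le ζ (p θ)
    rw [norm_sub_rev] at this
    linarith
  have h5 : 0 < ‖ζ‖ - P := by linarith
  rw [norm_div]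
  gcongr

theorem circleIntegral_div_sub_eq {F φ : ℂ → ℂ} {r : ℝ} (ζ : ℂ) :
    ∮ w in C(0, r), F w / (φ w - ζ) = ∫ θ in (0 : ℝ)..2 * Real.pi,
      (circleMap 0 r θ * I * F (circleMap 0 r θ)) / (φ (circleMap 0 r θ) - ζ) := by
  simp only [circleIntegral, deriv_circleMap, smul_eq_mul, mul_div_assoc]

theorem differentiableAt_circleIntegral_div_sub {F φ : ℂ → ℂ} {r : ℝ} (hr : 0 ≤ r)
    (hF : ContinuousOn F (sphere 0 r)) (hφ : ContinuousOn φ (sphere 0 r)) {ζ : ℂ}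
    (hζ : ζ ∉ φ '' sphere 0 r) :
    DifferentiableAt ℂ (fun ζ => ∮ w in C(0, r), F w / (φ w - ζ)) ζ := by
  have hm := fun θ => circleMap_mem_sphere (0 : ℂ) hr θ
  have hc := continuous_circleMap 0 r
  simp only [circleIntegral_div_sub_eq]
  refine differentiableAt_integral_div_sub
    (u := fun θ => circleMap 0 r θ * I * F (circleMap 0 r θ)) (p := fun θ => φ (circleMap 0 r θ))
    ((hc.mul continuous_const).mul (hF.comp_continuous hc hm)) (hφ.comp_continuous hc hm) ?_
  rintro ⟨θ, -, rfl⟩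
  exact hζ (mem_image_of_mem _ (hm θ))

theorem tendsto_circleIntegral_div_sub_cobounded {F φ : ℂ → ℂ} {r : ℝ} (hr : 0 ≤ r)
    (hF : ContinuousOn F (sphere 0 r)) (hφ : ContinuousOn φ (sphere 0 r)) :
    Tendsto (fun ζ => ∮ w in C(0, r), F w / (φ w - ζ)) (cobounded ℂ) (nhds 0) := by
  have hm := fun θ => circleMap_mem_sphere (0 : ℂ) hr θ
  have hc := continuous_circleMap 0 r
  simp only [circleIntegral_div_sub_eq]
  exact tendsto_integral_div_sub_cobounded
    (u := fun θ => circleMap 0 r θ * I * F (circleMap 0 r θ)) (p := fun θ => φ (circleMap 0 r θ))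
    ((hc.mul continuous_const).mul (hF.comp_continuous hc hm)) (hφ.comp_continuous hc hm) 0
    (2 * Real.pi)

theorem circleIntegral_div_sub_annulus {h : ℂ → ℂ} {r₁ r₂ : ℝ} {w₀ : ℂ} (h0 : 0 < r₁)
    (h1 : r₁ < ‖w₀‖) (h2 : ‖w₀‖ < r₂)
    (hh : ∀ w, r₁ ≤ ‖w‖ → ‖w‖ ≤ r₂ → DifferentiableAt ℂ h w) :
    (∮ w in C(0, r₂), h w / (w - w₀)) - ∮ w in C(0, r₁), h w / (w - w₀) =
      2 * Real.pi * I * h w₀ := by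
  have hd0 : DifferentiableAt ℂ h w₀ := hh w₀ h1.le h2.le
  have hds : ∀ w, r₁ ≤ ‖w‖ → ‖w‖ ≤ r₂ → ContinuousAt (dslope h w₀) w := by
    intro w hw1 hw2
    by_cases hw : w = w₀
    · rw [hw]
      exact continuousAt_dslope_same.2 hd0
    · exact (continuousAt_dslope_of_ne hw).2 (hh w hw1 hw2).continuousAt
  have hann := Complex.circleIntegral_eq_of_differentiable_on_annulus_off_countable (c := 0) h0
    (h1.trans h2).le (countable_singleton w₀) (f := dslope h w₀) (fun w hw => by
      refine (hds w ?_ ?_).continuousWithinAt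
      · simpa using hw.2
      · simpa using hw.1) (fun w hw => by
      refine (differentiableAt_dslope_of_ne hw.2).2 (hh w ?_ ?_)
      · exact le_of_lt (by simpa using hw.1.2)
      · exact le_of_lt (by simpa using hw.1.1))
  have hsplit : ∀ r, 0 < r → r₁ ≤ r → r ≤ r₂ → r ≠ ‖w₀‖ → ∮ w in C(0, r), dslope h w₀ w =
      (∮ w in C(0, r), h w / (w - w₀)) - h w₀ * ∮ w in C(0, r), (w - w₀)⁻¹ := by
    intro r hr hr1 hr2 hrw
    have hne : ∀ w ∈ sphere (0 : ℂ) r, w - w₀ ≠ 0 := by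
      intro w hw h
      rw [sub_eq_zero] at h
      rw [h] at hw
      exact hrw (by simpa using hw.symm)
    rw [← circleIntegral.integral_const_mul, ← circleIntegral.integral_sub]
    · refine circleIntegral.integral_congr hr.le fun w hw => ?_
      rw [dslope_of_ne h (sub_ne_zero.1 (hne w hw)), slope_def_field]
      ring
    · refine ContinuousOn.circleIntegrable hr.le (ContinuousOn.div (fun w hw => ?_) (by fun_prop) hne)
      have : ‖w‖ = r := by simpa using hw
      exact (hh w (by rw [this]; exact hr1) (by rw [this]; exact hr2)).continuousAt.continuousWithinAt
    · exact ContinuousOn.circleIntegrable hr.le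
        (continuousOn_const.mul (ContinuousOn.inv₀ (by fun_prop) hne))
  have hout : ∮ w in C(0, r₂), (w - w₀)⁻¹ = 2 * Real.pi * I :=
    circleIntegral.integral_sub_inv_of_mem_ball (by simpa using h2)
  have hin : ∮ w in C(0, r₁), (w - w₀)⁻¹ = 0 := by
    have hne : ∀ w ∈ closedBall (0 : ℂ) r₁, w - w₀ ≠ 0 := by
      intro w hw h
      rw [sub_eq_zero] at h
      rw [h] at hw
      exact absurd (by simpa using hw) h1.not_ge
    refine Complex.circleIntegral_eq_zero_of_differentiable_on_off_countable h0.le countable_empty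
      (ContinuousOn.inv₀ (by fun_prop) hne) fun w hw => ?_
    exact DifferentiableAt.inv (by fun_prop) (hne w (ball_subset_closedBall hw.1))
  rw [hsplit r₂ (h0.trans (h1.trans h2)) (h1.trans h2).le le_rfl h2.ne',
    hsplit r₁ h0 le_rfl (h1.trans h2).le h1.ne, hout, hin] at hann
  linear_combination hann

theorem circleIntegral_conformal_eq_neg {φ γ : ℂ → ℂ} {K : Set ℂ} (hK : IsClosed K)
    (hφ : DifferentiableOn ℂ φ (ball 0 1)) (hinj : InjOn φ (ball 0 1))
    (hKφ : K ⊆ φ '' ball 0 1) (hγ : DifferentiableOn ℂ γ Kᶜ)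
    (hγ0 : Tendsto γ (cobounded ℂ) (nhds 0)) {r : ℝ} (hr : 0 < r) (hr1 : r < 1)
    (hrK : ∀ w ∈ ball (0 : ℂ) 1, r ≤ ‖w‖ → φ w ∉ K) {ζ : ℂ} (hζ : ζ ∉ φ '' ball 0 1) :
    ∮ w in C(0, r), γ (φ w) * (deriv φ w / (φ w - ζ)) = -(2 * Real.pi * I * γ ζ) := by
  obtain ⟨s, hrs, hs1⟩ := exists_between hr1
  have hs := hr.trans hrs
  have hφ' : ∀ w ∈ ball (0 : ℂ) 1, DifferentiableAt ℂ φ w := fun w hw =>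
    hφ.differentiableAt (isOpen_ball.mem_nhds hw)
  have hdφ : ∀ w ∈ ball (0 : ℂ) 1, DifferentiableAt ℂ (deriv φ) w := fun w hw =>
    ((hφ.deriv isOpen_ball).differentiableAt (isOpen_ball.mem_nhds hw))
  have hγ' : ∀ z ∉ K, DifferentiableAt ℂ γ z := fun z hz =>
    hγ.differentiableAt (hK.isOpen_compl.mem_nhds hz)
  set F : ℂ → ℂ := fun w => γ (φ w) * deriv φ w
  have hFd : ∀ w ∈ ball (0 : ℂ) 1, r ≤ ‖w‖ → DifferentiableAt ℂ F w := fun w hw hw1 =>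
    ((hγ' _ (hrK w hw hw1)).comp w (hφ' w hw)).mul (hdφ w hw)
  have hsph : ∀ t, t < 1 → sphere (0 : ℂ) t ⊆ ball 0 1 := fun t ht =>
    sphere_subset_closedBall.trans (closedBall_subset_ball ht)
  have hFc : ∀ t, r ≤ t → t < 1 → ContinuousOn F (sphere 0 t) := fun t ht ht1 w hw =>
    (hFd w (hsph t ht1 hw) (by simpa [mem_sphere_zero_iff_norm.1 hw] using ht)).continuousAt.continuousWithinAt
  have hφc : ∀ t, t < 1 → ContinuousOn φ (sphere 0 t) := fun t ht =>
    hφ.continuousOn.mono (hsph t ht)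
  set J : ℝ → ℂ → ℂ := fun t ζ => ∮ w in C(0, t), F w / (φ w - ζ)
  have hoverlap : ∀ w₀, r < ‖w₀‖ → ‖w₀‖ < s →
      J s (φ w₀) = 2 * Real.pi * I * γ (φ w₀) + J r (φ w₀) := by
    intro w₀ hw1 hw2
    have hw₀ : w₀ ∈ ball (0 : ℂ) 1 := by simpa using hw2.trans hs1
    have hslope : ∀ w ∈ ball (0 : ℂ) 1, dslope φ w₀ w ≠ 0 := by
      intro w hw
      by_cases h : w = w₀
      · rw [h, dslope_same]
        exact deriv_ne_zero_of_injOn isOpen_ball hφ hinj hw₀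
      · rw [dslope_of_ne φ h, slope_def_field]
        exact div_ne_zero (sub_ne_zero.2 fun e => h (hinj hw hw₀ e)) (sub_ne_zero.2 h)
    have hann := circleIntegral_div_sub_annulus (h := fun w => F w / dslope φ w₀ w) hr hw1 hw2
      (fun w hwr hws => by
        have hw : w ∈ ball (0 : ℂ) 1 := by simpa using hws.trans_lt hs1
        refine (hFd w hw hwr).div ?_ (hslope w hw)
        exact ((Complex.differentiableOn_dslope (isOpen_ball.mem_nhds hw₀)).2 hφ).differentiableAt
          (isOpen_ball.mem_nhds hw))
    have hJ : ∀ t, 0 < t → t < 1 → t ≠ ‖w₀‖ →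
        ∮ w in C(0, t), F w / dslope φ w₀ w / (w - w₀) = J t (φ w₀) := by
      intro t ht ht1 hne
      refine circleIntegral.integral_congr ht.le fun w hw => ?_
      have hww : w ≠ w₀ := by
        rintro rfl
        exact hne (by simpa using hw.symm)
      have := sub_ne_zero.2 hww
      simp only [dslope_of_ne φ hww, slope_def_field, div_div]
      rw [div_mul_cancel₀ _ this]
    rw [hJ s hs hs1 hw2.ne', hJ r hr hr1 hw1.ne, dslope_same] at hann
    have hne := deriv_ne_zero_of_injOn isOpen_ball hφ hinj hw₀
    rw [show F w₀ / deriv φ w₀ = γ (φ w₀) from mul_div_cancel_right₀ _ hne] at hann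
    linear_combination hann
  set U : Set ℂ := φ '' ball 0 s
  set V : Set ℂ := (φ '' closedBall 0 r)ᶜ
  have hsub1 : ball (0 : ℂ) s ⊆ ball 0 1 := ball_subset_ball hs1.le
  have hsub2 : closedBall (0 : ℂ) r ⊆ ball 0 1 := closedBall_subset_ball hr1
  have hU : IsOpen U := isOpen_image_of_injOn isOpen_ball (hφ.mono hsub1) (hinj.mono hsub1)
  have hcpt : IsCompact (φ '' closedBall 0 r) :=
    (isCompact_closedBall 0 r).image_of_continuousOn (hφ.continuousOn.mono hsub2)
  have hV : IsOpen V := hcpt.isClosed.isOpen_compl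
  have hVK : ∀ z ∈ V, z ∉ K := by
    intro z hz hzK
    obtain ⟨w, hw, rfl⟩ := hKφ hzK
    refine hrK w hw (le_of_not_ge fun h => hz ⟨w, by simpa using h, rfl⟩) hzK
  classical
  set H : ℂ → ℂ := fun z => if z ∈ U then J s z else 2 * Real.pi * I * γ z + J r z
  have hHV : ∀ z ∈ V, H z = 2 * Real.pi * I * γ z + J r z := by
    intro z hz
    by_cases hzU : z ∈ U
    · obtain ⟨w, hw, rfl⟩ := hzU
      have hw' : w ∈ ball (0 : ℂ) s := hw
      rw [show H (φ w) = J s (φ w) from if_pos (mem_image_of_mem φ hw')]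
      refine hoverlap w (lt_of_not_ge fun h => hz ⟨w, by simpa using h, rfl⟩) (by simpa using hw')
    · simp only [H, if_neg hzU]
  have hdiff : Differentiable ℂ H := by
    intro z
    by_cases hzU : z ∈ U
    · have : J s =ᶠ[nhds z] H := by
        filter_upwards [hU.mem_nhds hzU] with x hx
        simp only [H, if_pos hx]
      refine DifferentiableAt.congr_of_eventuallyEq ?_ this.symm
      refine differentiableAt_circleIntegral_div_sub hs.le (hFc s hrs.le hs1) (hφc s hs1) ?_
      rintro ⟨w, hw, rfl⟩
      obtain ⟨w', hw', he⟩ := hzU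
      have := hinj (hsub1 hw') (hsph s hs1 hw) he
      subst this
      exact absurd (mem_ball_zero_iff.1 hw') (by rw [mem_sphere_zero_iff_norm.1 hw]; exact lt_irrefl s)
    · have hzV : z ∈ V := by
        rintro ⟨w, hw, rfl⟩
        exact hzU ⟨w, closedBall_subset_ball hrs hw, rfl⟩
      refine DifferentiableAt.congr_of_eventuallyEq
        (f := fun z => 2 * Real.pi * I * γ z + J r z) ?_ ?_
      · refine ((hγ' z (hVK z hzV)).const_mul _).add ?_
        exact differentiableAt_circleIntegral_div_sub hr.le (hFc r le_rfl hr1) (hφc r hr1)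
          fun h => hzV (image_mono sphere_subset_closedBall h)
      · filter_upwards [hV.mem_nhds hzV] with x hx
        exact hHV x hx
  have hlim : Tendsto H (cobounded ℂ) (nhds 0) := by
    have h1 : Tendsto (fun z => 2 * Real.pi * I * γ z + J r z) (cobounded ℂ) (nhds 0) := by
      simpa using (hγ0.const_mul (2 * Real.pi * I)).add
        (tendsto_circleIntegral_div_sub_cobounded hr.le (hFc r le_rfl hr1) (hφc r hr1))
    refine h1.congr' ?_
    filter_upwards [Bornology.isBounded_def.1 hcpt.isBounded] with z hz
    exact (hHV z hz).symm
  have hzero := hdiff.apply_eq_of_tendsto_cocompact ζ (by rwa [← Metric.cobounded_eq_cocompact])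
  rw [hHV ζ fun h => hζ (image_mono hsub2 h)] at hzero
  have hJr : ∮ w in C(0, r), γ (φ w) * (deriv φ w / (φ w - ζ)) = J r ζ := by
    simp only [J, F, mul_div_assoc]
  rw [hJr]
  linear_combination hzero

theorem det_toSpanSingleton_restrictScalars (c : ℂ) :
    ((ContinuousLinearMap.toSpanSingleton ℂ c).restrictScalars ℝ).det = ‖c‖ ^ 2 := by
  simp [ContinuousLinearMap.det, LinearMap.det_restrictScalars, Algebra.norm_complex_eq,
    Complex.normSq_eq_norm_sq]

theorem hasFDerivWithinAt_restrictScalars_of_differentiableOn {φ : ℂ → ℂ} {U : Set ℂ}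
    (hU : IsOpen U) (hφ : DifferentiableOn ℂ φ U) (w : ℂ) (hw : w ∈ U) :
    HasFDerivWithinAt φ
      ((ContinuousLinearMap.toSpanSingleton ℂ (deriv φ w)).restrictScalars ℝ) U w :=
  ((hφ.differentiableAt (hU.mem_nhds hw)).hasDerivAt.hasFDerivAt.restrictScalars ℝ).hasFDerivWithinAt

theorem integral_image_norm_sq {φ : ℂ → ℂ} {U : Set ℂ} (hU : IsOpen U)
    (hφ : DifferentiableOn ℂ φ U) (hinj : InjOn φ U) (h : ℂ → ℂ) :
    ∫ z in φ '' U, ‖h z‖ ^ 2 = ∫ w in U, ‖h (φ w) * deriv φ w‖ ^ 2 := by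
  rw [integral_image_eq_integral_abs_det_fderiv_smul volume hU.measurableSet
    (hasFDerivWithinAt_restrictScalars_of_differentiableOn hU hφ) hinj]
  simp only [det_toSpanSingleton_restrictScalars, abs_pow, abs_norm, smul_eq_mul, norm_mul,
    mul_pow, mul_comm]

theorem integrableOn_image_norm_sq_iff {φ : ℂ → ℂ} {U : Set ℂ} (hU : IsOpen U)
    (hφ : DifferentiableOn ℂ φ U) (hinj : InjOn φ U) (h : ℂ → ℂ) :
    IntegrableOn (fun z => ‖h z‖ ^ 2) (φ '' U) ↔
      IntegrableOn (fun w => ‖h (φ w) * deriv φ w‖ ^ 2) U := by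
  rw [integrableOn_image_iff_integrableOn_abs_det_fderiv_smul volume hU.measurableSet
    (hasFDerivWithinAt_restrictScalars_of_differentiableOn hU hφ) hinj]
  simp only [det_toSpanSingleton_restrictScalars, abs_pow, abs_norm, smul_eq_mul, norm_mul,
    mul_pow, mul_comm]

theorem circleIntegral_mul_pow_eq_fourierCoef (f : ℂ → ℂ) (m : ℕ) :
    ∮ w in C(0, 1), f w * w ^ m = 2 * Real.pi * I * fourierCoef f (-((m : ℤ) + 1)) := by
  have hpt : ∀ θ : ℝ, deriv (circleMap 0 1) θ • (f (circleMap 0 1 θ) * circleMap 0 1 θ ^ m) =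
      I * (f (Complex.exp (θ * I)) *
        Complex.exp (-(I * ((-((m : ℤ) + 1) : ℤ) : ℂ) * (θ : ℂ)))) := by
    intro θ
    have h1 : circleMap 0 1 θ = Complex.exp (θ * I) := by simp [circleMap]
    have h2 : Complex.exp (-(I * ((-((m : ℤ) + 1) : ℤ) : ℂ) * (θ : ℂ))) =
        Complex.exp (θ * I) ^ (m + 1) := by
      rw [← Complex.exp_nat_mul]
      push_cast
      ring_nf
    rw [deriv_circleMap, h1, h2, smul_eq_mul]
    ring
  have hpi : (Real.pi : ℂ) ≠ 0 := by exact_mod_cast Real.pi_ne_zero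
  have hX : ∀ X : ℂ, I * X = 2 * Real.pi * I * (1 / (2 * Real.pi) * X) := by
    intro X
    field_simp
  simp only [circleIntegral, hpt, intervalIntegral.integral_const_mul, fourierCoef]
  exact hX _

theorem norm_sum_mul_le_of_conformal {φ γ : ℂ → ℂ} {K : Set ℂ} (hK : IsClosed K)
    (hφ : DifferentiableOn ℂ φ (ball 0 1)) (hφc : ContinuousOn φ (closedBall 0 1))
    (hinj : InjOn φ (closedBall 0 1)) (hKφ : K ⊆ φ '' ball 0 1)
    (hγ : DifferentiableOn ℂ γ Kᶜ) (hγ0 : Tendsto γ (cobounded ℂ) (nhds 0))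
    (hs : Summable fun k : ℕ =>
      ((k : ℝ) + 1) * ‖fourierCoef (γ ∘ φ) (-((k : ℤ) + 1))‖ ^ 2) {C : ℝ}
    (hC : Real.pi * ∑' k : ℕ,
      ((k : ℝ) + 1) * ‖fourierCoef (γ ∘ φ) (-((k : ℤ) + 1))‖ ^ 2 ≤ C)
    (s : Finset ℂ) (c : ℂ → ℂ) (hζ : ∀ ζ ∈ s, ζ ∉ φ '' closedBall 0 1) :
    ‖∑ ζ ∈ s, c ζ * γ ζ‖ ≤
      Real.pi⁻¹ * (√C * √(∫ z in φ '' ball 0 1, ‖∑ ζ ∈ s, c ζ / (z - ζ)‖ ^ 2)) := by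
  have hbc : ball (0 : ℂ) 1 ⊆ closedBall 0 1 := ball_subset_closedBall
  have hinj' := hinj.mono hbc
  obtain ⟨r, ⟨hr, hr1⟩, hE⟩ := exists_pos_lt_subset_ball one_pos
    (hφc.preimage_isClosed_of_isClosed isClosed_closedBall hK)
    (show closedBall (0 : ℂ) 1 ∩ φ ⁻¹' K ⊆ ball 0 1 by
      rintro w ⟨hw, hwK⟩
      obtain ⟨w', hw', he⟩ := hKφ hwK
      exact hinj (hbc hw') hw he ▸ hw')
  have hrK : ∀ w ∈ closedBall (0 : ℂ) 1, r ≤ ‖w‖ → φ w ∉ K := fun w hw hwr hwK =>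
    hwr.not_gt (mem_ball_zero_iff.1 (hE ⟨hw, hwK⟩))
  have hγ' : ∀ z ∉ K, DifferentiableAt ℂ γ z := fun z hz =>
    hγ.differentiableAt (hK.isOpen_compl.mem_nhds hz)
  have hφ' : ∀ w ∈ ball (0 : ℂ) 1, DifferentiableAt ℂ φ w := fun w hw =>
    hφ.differentiableAt (isOpen_ball.mem_nhds hw)
  have hFc : ContinuousOn (γ ∘ φ) (closedBall 0 1 \ ball 0 r) := fun w hw =>
    (hγ' _ (hrK w hw.1 (by simpa using hw.2))).continuousAt.comp_continuousWithinAt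
      ((hφc w hw.1).mono sdiff_subset)
  have hsph : sphere (0 : ℂ) r ⊆ ball 0 1 :=
    sphere_subset_closedBall.trans (closedBall_subset_ball hr1)
  have hFs : ContinuousOn (γ ∘ φ) (sphere 0 r) := hFc.mono fun w hw =>
    ⟨hbc (hsph hw), by simp [mem_sphere_zero_iff_norm.1 hw]⟩
  have ha : ∀ m : ℕ, ∮ w in C(0, r), (γ ∘ φ) w * w ^ m =
      2 * Real.pi * I * fourierCoef (γ ∘ φ) (-((m : ℤ) + 1)) := by
    intro m
    rw [← circleIntegral_mul_pow_eq_fourierCoef]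
    refine (Complex.circleIntegral_eq_of_differentiable_on_annulus_off_countable hr hr1.le
      countable_empty (hFc.mul (continuous_pow m).continuousOn) fun w hw => ?_).symm
    have hw1 := hw.1.1
    have hwr : r < ‖w‖ := by simpa using hw.1.2
    exact ((hγ' _ (hrK w (hbc hw1) hwr.le)).comp w (hφ' w hw1)).mul (differentiableAt_pow m)
  set h : ℂ → ℂ := fun z => ∑ ζ ∈ s, c ζ / (z - ζ) with hh
  have hne : ∀ ζ ∈ s, ∀ z ∈ φ '' closedBall 0 1, z - ζ ≠ 0 := fun ζ hζs z hz e =>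
    hζ ζ hζs (sub_eq_zero.1 e ▸ hz)
  have hhd : ∀ z ∈ φ '' closedBall 0 1, DifferentiableAt ℂ h z := fun z hz =>
    DifferentiableAt.fun_sum fun ζ hζs =>
      (differentiableAt_const _).div (by fun_prop) (hne ζ hζs z hz)
  have hh2 : IntegrableOn (fun z => ‖h z‖ ^ 2) (φ '' ball 0 1) := by
    refine IntegrableOn.mono_set (ContinuousOn.integrableOn_compact
      ((isCompact_closedBall 0 1).image_of_continuousOn hφc) ?_) (image_mono hbc)
    exact ContinuousOn.pow (ContinuousOn.norm fun z hz => (hhd z hz).continuousAt.continuousWithinAt) 2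
  have hB : DifferentiableOn ℂ (fun w => h (φ w) * deriv φ w) (ball 0 1) := fun w hw =>
    (((hhd _ (mem_image_of_mem φ (hbc hw))).comp w (hφ' w hw)).mul
      ((hφ.deriv isOpen_ball).differentiableAt (isOpen_ball.mem_nhds hw))).differentiableWithinAt
  have key := norm_circleIntegral_mul_le hr hr1 hFs hB
    ((integrableOn_image_norm_sq_iff isOpen_ball hφ hinj' h).1 hh2) ha hs hC
  rw [← integral_image_norm_sq isOpen_ball hφ hinj' h] at key
  have heq : ∮ w in C(0, r), (γ ∘ φ) w * (h (φ w) * deriv φ w) =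
      -(2 * Real.pi * I) * ∑ ζ ∈ s, c ζ * γ ζ := by
    have h1 : ∮ w in C(0, r), (γ ∘ φ) w * (h (φ w) * deriv φ w) =
        ∮ w in C(0, r), ∑ ζ ∈ s, c ζ * (γ (φ w) * (deriv φ w / (φ w - ζ))) := by
      refine circleIntegral.integral_congr hr.le fun w _ => ?_
      simp only [hh, Finset.sum_mul, Finset.mul_sum, Function.comp]
      refine Finset.sum_congr rfl fun ζ _ => ?_
      ring
    rw [h1, circleIntegral.integral_fun_sum, Finset.mul_sum]
    · refine Finset.sum_congr rfl fun ζ hζs => ?_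
      rw [circleIntegral.integral_const_mul, circleIntegral_conformal_eq_neg hK hφ hinj' hKφ hγ hγ0
        hr hr1 (fun w hw => hrK w (hbc hw)) fun h => hζ ζ hζs (image_mono hbc h)]
      ring
    · intro ζ hζs
      refine ContinuousOn.circleIntegrable hr.le (continuousOn_const.mul (hFs.mul (ContinuousOn.div
        ((hφ.deriv isOpen_ball).continuousOn.mono hsph)
        ((hφ.continuousOn.mono hsph).sub continuousOn_const) fun w hw => ?_)))
      exact hne ζ hζs _ (mem_image_of_mem φ (hbc (hsph hw)))
  rw [heq, norm_mul] at key
  have hnorm : ‖-(2 * Real.pi * I : ℂ)‖ = 2 * Real.pi := by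
    simp [abs_of_pos Real.pi_pos]
  rw [hnorm] at key
  rw [le_inv_mul_iff₀ Real.pi_pos]
  linarith

theorem norm_sum_mul_le_of_nested {G : Set ℂ} (hbd : volume (frontier G) = 0) {Gs : ℕ → Set ℂ}
    (hopen : ∀ n, IsOpen (Gs n)) (hbdd : ∀ n, IsBounded (Gs n))
    (hnest : ∀ n, closure (Gs (n + 1)) ⊆ Gs n) (hinter : (⋂ n, Gs n) = closure G)
    {γ : ℂ → ℂ} {C : ℝ}
    (hb : ∀ n, ∀ (s : Finset ℂ) (c : ℂ → ℂ), (∀ ζ ∈ s, ζ ∉ closure (Gs n)) →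
      ‖∑ ζ ∈ s, c ζ * γ ζ‖ ≤ C * √(∫ z in Gs n, ‖∑ ζ ∈ s, c ζ / (z - ζ)‖ ^ 2))
    (s : Finset ℂ) (c : ℂ → ℂ) (hζ : ∀ ζ ∈ s, ζ ∉ closure G) :
    ‖∑ ζ ∈ s, c ζ * γ ζ‖ ≤ C * √(∫ z in G, ‖∑ ζ ∈ s, c ζ / (z - ζ)‖ ^ 2) := by
  have hanti : Antitone Gs := antitone_nat_of_succ_le fun n => subset_closure.trans (hnest n)
  have hev : ∀ᶠ n in atTop, ∀ ζ ∈ s, ζ ∉ closure (Gs n) := by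
    rw [Filter.eventually_all_finset]
    intro ζ hζs
    have h1 := hζ ζ hζs
    rw [← hinter, mem_iInter, not_forall] at h1
    obtain ⟨N, hN⟩ := h1
    filter_upwards [eventually_ge_atTop (N + 1)] with n hn h
    exact hN (hnest N (closure_mono (hanti hn) h))
  have hint : ∃ n, IntegrableOn (fun z => ‖∑ ζ ∈ s, c ζ / (z - ζ)‖ ^ 2) (Gs n) := by
    obtain ⟨n, hn⟩ := hev.exists
    refine ⟨n, IntegrableOn.mono_set (ContinuousOn.integrableOn_compact
      (hbdd n).isCompact_closure ?_) subset_closure⟩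
    refine ContinuousOn.pow (ContinuousOn.norm ?_) 2
    refine continuousOn_finsetSum _ fun ζ hζs => continuousOn_const.div (by fun_prop) ?_
    intro z hz e
    exact hn ζ hζs (sub_eq_zero.1 e ▸ hz)
  have hlim := tendsto_setIntegral_of_antitone (fun n => (hopen n).measurableSet) hanti hint
  rw [hinter, setIntegral_congr_set (closure_ae_eq_of_null_frontier hbd)] at hlim
  refine ge_of_tendsto ((hlim.sqrt).const_mul C) ?_
  filter_upwards [hev] with n hn
  exact hb n s c hn

theorem norm_le_inv_mul_sqrt_integral {h : ℂ → ℂ} {z : ℂ} {r : ℝ} (hr : 0 < r)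
    (hh : DifferentiableOn ℂ h (closedBall z r)) :
    ‖h z‖ ≤ (√Real.pi * r)⁻¹ * √(∫ w in ball z r, ‖h w‖ ^ 2) := by
  have hmaps : MapsTo (fun w => z + w) (closedBall 0 r) (closedBall z r) := by
    intro w hw
    simpa using hw
  have hB : DifferentiableOn ℂ (fun w => h (z + w)) (closedBall 0 r) :=
    hh.comp (by fun_prop) hmaps
  have hmean := integral_ball_conj_pow_mul hr.le hB.continuousOn 0 (h z) fun ρ hρ => by
    have := (hB.diffContOnCl_ball
      (closedBall_subset_closedBall hρ.2.le)).circleIntegral_sub_inv_smul (mem_ball_self hρ.1)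
    simpa [div_eq_inv_mul] using this
  have htrans : ∫ w in ball 0 r, h (z + w) = ∫ w in ball z r, h w := by
    have := (measurePreserving_add_left volume z).setIntegral_preimage_emb
      (measurableEmbedding_addLeft z) h (ball z r)
    rw [← this]
    congr 2
    ext w
    simp
  simp only [pow_zero, one_mul, htrans] at hmean
  have hc2 : MemLp h 2 (volume.restrict (ball z r)) := by
    have hc := hh.continuousOn.mono ball_subset_closedBall
    rw [memLp_two_iff_integrable_sq_norm (hc.aestronglyMeasurable measurableSet_ball)]
    exact ((hh.continuousOn.norm.pow 2).integrableOn_compact (isCompact_closedBall z r)).mono_set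
      ball_subset_closedBall
  have : IsFiniteMeasure (volume.restrict (ball z r)) :=
    isFiniteMeasure_restrict.2 measure_ball_lt_top.ne
  have hcs := norm_integral_mul_le_sqrt_mul_sqrt hc2
    (memLp_const (μ := volume.restrict (ball z r)) (1 : ℂ))
  have hvol : ∫ _ in ball z r, ‖(1 : ℂ)‖ ^ 2 = Real.pi * r ^ 2 := by
    simp [Measure.real, Complex.volume_ball, hr.le, mul_comm]
  simp only [mul_one] at hcs
  rw [hmean, hvol, Real.sqrt_mul Real.pi_pos.le, Real.sqrt_sq hr.le] at hcs
  have hl : ‖(Real.pi * (r : ℂ) ^ (2 * 0 + 2) / ((0 : ℕ) + 1) * h z : ℂ)‖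
      = (√Real.pi * r) * ((√Real.pi * r) * ‖h z‖) := by
    have hs := Real.mul_self_sqrt Real.pi_pos.le
    simp [abs_of_pos Real.pi_pos, abs_of_pos hr]
    linear_combination (-r ^ 2 * ‖h z‖) * hs
  rw [hl, mul_comm (√(∫ w in ball z r, ‖h w‖ ^ 2))] at hcs
  have hpos : 0 < √Real.pi * r := mul_pos (Real.sqrt_pos.2 Real.pi_pos) hr
  rw [le_inv_mul_iff₀ hpos]
  exact le_of_mul_le_mul_left hcs hpos

theorem norm_sq_eq_integral_norm_sq {α : Type*} [MeasurableSpace α] {μ : Measure α}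
    (f : Lp ℂ 2 μ) : ‖f‖ ^ 2 = ∫ x, ‖f x‖ ^ 2 ∂μ := by
  have h : (inner ℂ f f : ℂ) = ∫ x, inner ℂ (f x) (f x) ∂μ := L2.inner_def f f
  simp only [inner_self_eq_norm_sq_to_K] at h
  have h2 : ∫ x, ((‖f x‖ : ℂ)) ^ 2 ∂μ = ((∫ x, ‖f x‖ ^ 2 ∂μ : ℝ) : ℂ) := by
    rw [← integral_complex_ofReal]
    simp
  exact Complex.ofReal_injective ((Complex.ofReal_pow _ _).trans (h.trans h2))

theorem isClosed_setOf_ae_eq_differentiableOn {G : Set ℂ} (hG : IsOpen G) :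
    IsClosed {f : Lp ℂ 2 (volume.restrict G) |
      ∃ h, DifferentiableOn ℂ h G ∧ f =ᵐ[volume.restrict G] h} := by
  refine isClosed_of_closure_subset fun g hg => ?_
  obtain ⟨f, hf, hlim⟩ := mem_closure_iff_seq_limit.1 hg
  choose h hd hfh using hf
  have hle : ∀ z r, 0 < r → closedBall z r ⊆ G → ∀ m n,
      dist (h m z) (h n z) ≤ (√Real.pi * r)⁻¹ * dist (f m) (f n) := by
    intro z r hr hzr m n
    have h1 := norm_le_inv_mul_sqrt_integral (h := fun w => h m w - h n w) hr
      (((hd m).sub (hd n)).mono hzr)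
    have h2 : ∫ w in ball z r, ‖h m w - h n w‖ ^ 2 ≤ ‖f m - f n‖ ^ 2 := by
      rw [norm_sq_eq_integral_norm_sq]
      have hae : (fun w => ‖h m w - h n w‖ ^ 2) =ᵐ[volume.restrict G]
          fun w => ‖(f m - f n : Lp ℂ 2 (volume.restrict G)) w‖ ^ 2 := by
        filter_upwards [hfh m, hfh n, Lp.coeFn_sub (f m) (f n)] with w e1 e2 e3
        rw [e3, Pi.sub_apply, e1, e2]
      rw [← integral_congr_ae hae]
      refine setIntegral_mono_set ?_ (Eventually.of_forall fun w => by positivity)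
        (ball_subset_closedBall.trans hzr).eventuallyLE
      exact (((memLp_two_iff_integrable_sq_norm (Lp.aestronglyMeasurable _)).1
        (Lp.memLp (f m - f n))).congr hae.symm)
    rw [dist_eq_norm, dist_eq_norm]
    refine h1.trans ?_
    gcongr
    exact Real.sqrt_le_iff.2 ⟨norm_nonneg _, h2⟩
  have hcau := hlim.cauchySeq
  have hloc : ∀ z ∈ G, ∃ U ∈ nhds z, U ⊆ G ∧ UniformCauchySeqOn h atTop U := by
    intro z hz
    obtain ⟨r, hr, hb⟩ := Metric.nhds_basis_closedBall.mem_iff.1 (hG.mem_nhds hz)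
    refine ⟨ball z (r / 2), ball_mem_nhds z (by positivity),
      (ball_subset_closedBall.trans (closedBall_subset_closedBall (by linarith))).trans hb, ?_⟩
    have hpos : 0 < (√Real.pi * (r / 2))⁻¹ := by positivity
    rw [Metric.uniformCauchySeqOn_iff]
    intro ε hε
    obtain ⟨N, hN⟩ := Metric.cauchySeq_iff.1 hcau (ε / (√Real.pi * (r / 2))⁻¹) (by positivity)
    refine ⟨N, fun m hm n hn x hx => ?_⟩
    have hsub : closedBall x (r / 2) ⊆ G := by
      refine (closedBall_subset_closedBall' ?_).trans hb
      have := mem_ball.1 hx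
      linarith
    refine (hle x (r / 2) (by positivity) hsub m n).trans_lt ?_
    rw [← lt_div_iff₀' hpos]
    exact hN m hm n hn
  have hpt : ∀ z ∈ G, ∃ l, Tendsto (fun n => h n z) atTop (nhds l) := by
    intro z hz
    obtain ⟨U, hU, -, hc⟩ := hloc z hz
    exact cauchySeq_tendsto_of_complete (hc.cauchySeq (mem_of_mem_nhds hU))
  choose! l hl using hpt
  refine ⟨l, ?_, ?_⟩
  · refine TendstoLocallyUniformlyOn.differentiableOn (F := h) (φ := atTop) ?_
      (Eventually.of_forall hd) hG
    rw [tendstoLocallyUniformlyOn_iff_forall_tendsto]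
    intro z hz
    obtain ⟨U, hU, hUG, hc⟩ := hloc z hz
    have := hc.tendstoUniformlyOn_of_tendsto fun x hx => hl x (hUG hx)
    rw [tendstoUniformlyOn_iff_tendsto] at this
    refine this.mono_left (Filter.prod_mono_right _ ?_)
    exact le_principal_iff.2 (mem_nhdsWithin_of_mem_nhds hU)
  · obtain ⟨ns, hns, hae⟩ := (tendstoInMeasure_of_tendsto_Lp hlim).exists_seq_tendsto_ae
    filter_upwards [hae, ae_all_iff.2 hfh, ae_restrict_mem hG.measurableSet] with z h1 h2 h3
    refine tendsto_nhds_unique h1 (((hl z h3).comp hns.tendsto_atTop).congr fun n => ?_)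
    exact (h2 _).symm

theorem exists_inner_eq_of_norm_sum_le {H X : Type*} [NormedAddCommGroup H]
    [InnerProductSpace ℂ H] [CompleteSpace H] {v : X → H} {y : X → ℂ} {M : ℝ}
    (hM : ∀ (s : Finset X) (c : X → ℂ), ‖∑ x ∈ s, c x * y x‖ ≤ M * ‖∑ x ∈ s, c x • v x‖) :
    ∃ g : H, ∀ x, inner ℂ g (v x) = y x := by
  set A := Finsupp.linearCombination ℂ v with hA
  set B := Finsupp.linearCombination ℂ y with hB
  have hAB : ∀ c, ‖B c‖ ≤ M * ‖A c‖ := fun c => by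
    simpa [hA, hB, Finsupp.linearCombination_apply, Finsupp.sum] using hM c.support c
  have hker : A.ker ≤ B.ker := by
    intro c hc
    rw [LinearMap.mem_ker] at hc ⊢
    have := hAB c
    rw [hc, norm_zero, mul_zero] at this
    exact norm_le_zero_iff.1 this
  set ℓ : A.range →ₗ[ℂ] ℂ := A.ker.liftQ B hker ∘ₗ A.quotKerEquivRange.symm.toLinearMap with hℓ
  have hℓA : ∀ c, ℓ ⟨A c, LinearMap.mem_range_self A c⟩ = B c := by
    intro c
    have : A.quotKerEquivRange.symm ⟨A c, LinearMap.mem_range_self A c⟩ = A.ker.mkQ c :=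
      A.quotKerEquivRange_symm_apply_image c _
    simp [hℓ, this]
  obtain ⟨L, hL, -⟩ := exists_extension_norm_eq A.range (ℓ.mkContinuous M (by
    rintro ⟨_, c, rfl⟩
    rw [hℓA]
    exact hAB c))
  refine ⟨(InnerProductSpace.toDual ℂ H).symm L, fun x => ?_⟩
  have h1 : A (Finsupp.single x 1) = v x := by simp [hA]
  have h2 : B (Finsupp.single x 1) = y x := by simp [hB]
  rw [InnerProductSpace.toDual_symm_apply, ← h1, ← h2, ← hℓA]
  exact hL ⟨A (Finsupp.single x 1), LinearMap.mem_range_self A _⟩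

theorem exists_mem_closure_span_inner_eq_of_norm_sum_le {H X : Type*} [NormedAddCommGroup H]
    [InnerProductSpace ℂ H] [CompleteSpace H] {v : X → H} {y : X → ℂ} {M : ℝ}
    (hM : ∀ (s : Finset X) (c : X → ℂ), ‖∑ x ∈ s, c x * y x‖ ≤ M * ‖∑ x ∈ s, c x • v x‖) :
    ∃ g ∈ (Submodule.span ℂ (range v)).topologicalClosure, ∀ x, inner ℂ g (v x) = y x := by
  set S := (Submodule.span ℂ (range v)).topologicalClosure
  have : CompleteSpace S := (Submodule.isClosed_topologicalClosure _).completeSpace_coe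
  have hv : ∀ x, v x ∈ S := fun x =>
    Submodule.le_topologicalClosure _ (Submodule.subset_span (mem_range_self x))
  obtain ⟨g, hg⟩ := exists_inner_eq_of_norm_sum_le (v := fun x => (⟨v x, hv x⟩ : S)) (y := y)
    (M := M) fun s c => by
      convert hM s c
      rw [← Submodule.norm_coe]
      simp
  exact ⟨g, g.2, hg⟩

theorem memLp_inv_sub {G : Set ℂ} (hG : IsBounded G) {ζ : ℂ} (hζ : ζ ∉ closure G) :
    MemLp (fun z => (z - ζ)⁻¹) 2 (volume.restrict G) := by
  refine MemLp.mono_measure (Measure.restrict_mono subset_closure le_rfl) ?_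
  have hc : ContinuousOn (fun z => (z - ζ)⁻¹) (closure G) :=
    ContinuousOn.inv₀ (by fun_prop) fun z hz e => hζ (sub_eq_zero.1 e ▸ hz)
  rw [memLp_two_iff_integrable_sq_norm (hc.aestronglyMeasurable isClosed_closure.measurableSet)]
  exact (hc.norm.pow 2).integrableOn_compact hG.isCompact_closure

theorem exists_cauchyTransform_eq_of_norm_sum_le {G : Set ℂ} (hG : IsOpen G)
    (hGb : IsBounded G) {γ : ℂ → ℂ} {C : ℝ}
    (hC : ∀ (s : Finset ℂ) (c : ℂ → ℂ), (∀ ζ ∈ s, ζ ∉ closure G) →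
      ‖∑ ζ ∈ s, c ζ * γ ζ‖ ≤ C * √(∫ z in G, ‖∑ ζ ∈ s, c ζ / (z - ζ)‖ ^ 2)) :
    ∃ g : ℂ → ℂ, MemB2 G g ∧ ∀ ζ ∉ closure G, γ ζ = cauchyTransform G g ζ := by
  let v : {ζ : ℂ // ζ ∉ closure G} → Lp ℂ 2 (volume.restrict G) := fun ζ =>
    (memLp_inv_sub hGb ζ.2).toLp
  have hv : ∀ ζ, v ζ =ᵐ[volume.restrict G] fun z => (z - (ζ : ℂ))⁻¹ := fun ζ =>
    (memLp_inv_sub hGb ζ.2).coeFn_toLp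
  obtain ⟨f, hf, hfγ⟩ := exists_mem_closure_span_inner_eq_of_norm_sum_le (v := v)
    (y := fun ζ => γ ζ) (M := C) fun s c => by
      have hinj : Function.Injective (Subtype.val : {ζ : ℂ // ζ ∉ closure G} → ℂ) :=
        Subtype.val_injective
      have h1 := hC (s.map ⟨Subtype.val, hinj⟩) (Function.extend Subtype.val c 0) (by simp +contextual)
      simp only [Finset.sum_map, Function.Embedding.coeFn_mk, hinj.extend_apply] at h1
      refine h1.trans_eq ?_
      rw [← Real.sqrt_sq (norm_nonneg (∑ x ∈ s, c x • v x)), norm_sq_eq_integral_norm_sq]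
      congr 2
      refine integral_congr_ae ?_
      have hall : ∀ᵐ z ∂volume.restrict G, ∀ x ∈ s, (c x • v x : Lp ℂ 2 _) z = c x / (z - x) := by
        rw [Filter.eventually_all_finset]
        intro x _
        filter_upwards [hv x, Lp.coeFn_smul (c x) (v x)] with z e1 e2
        rw [e2, Pi.smul_apply, e1, smul_eq_mul, div_eq_mul_inv]
      filter_upwards [hall, Lp.coeFn_finsetSum s fun x => c x • v x] with z e1 e2
      rw [e2, Finset.sum_apply, Finset.sum_congr rfl e1]
  have hspan : (Submodule.span ℂ (range v) : Set (Lp ℂ 2 (volume.restrict G))) ⊆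
      {f | ∃ h, DifferentiableOn ℂ h G ∧ f =ᵐ[volume.restrict G] h} := by
    intro f hf
    induction hf using Submodule.span_induction with
    | mem x hx =>
      obtain ⟨ζ, rfl⟩ := hx
      refine ⟨_, DifferentiableOn.inv (by fun_prop) fun z hz e => ?_, hv ζ⟩
      exact ζ.2 (sub_eq_zero.1 e ▸ subset_closure hz)
    | zero => exact ⟨0, differentiableOn_const 0, Lp.coeFn_zero ..⟩
    | add x y _ _ hx hy =>
      obtain ⟨h₁, hd₁, he₁⟩ := hx
      obtain ⟨h₂, hd₂, he₂⟩ := hy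
      exact ⟨h₁ + h₂, hd₁.add hd₂, (Lp.coeFn_add x y).trans (he₁.add he₂)⟩
    | smul a x _ hx =>
      obtain ⟨h, hd, he⟩ := hx
      exact ⟨a • h, hd.const_smul a, (Lp.coeFn_smul a x).trans (he.const_smul a)⟩
  obtain ⟨h, hd, he⟩ := closure_minimal hspan (isClosed_setOf_ae_eq_differentiableOn hG) hf
  have hpi : (Real.pi : ℂ) ≠ 0 := by exact_mod_cast Real.pi_ne_zero
  refine ⟨fun z => Real.pi * h z, ⟨hd.const_mul _, ?_⟩, fun ζ hζ => ?_⟩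
  · have hL := (memLp_congr_ae he).1 (Lp.memLp f)
    exact (memLp_two_iff_integrable_sq_norm (hL.const_mul _).1).1 (hL.const_mul _)
  · rw [← hfγ ⟨ζ, hζ⟩, cauchyTransform, L2.inner_def, ← integral_const_mul]
    refine integral_congr_ae ?_
    filter_upwards [he, hv ⟨ζ, hζ⟩] with z e1 e2
    rw [e1, e2, RCLike.inner_apply', map_mul, Complex.conj_ofReal]
    field_simp

theorem IsJordanDomain.isOpen {G : Set ℂ} (hG : IsJordanDomain G) : IsOpen G := by
  obtain ⟨J, ⟨f, hf, -, rfl⟩, -, z, -, rfl⟩ := hG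
  exact ((isCompact_sphere (0 : ℂ) 1).image_of_continuousOn hf).isClosed.isOpen_compl
    |>.connectedComponentIn

theorem IsJordanDomain.isBounded {G : Set ℂ} (hG : IsJordanDomain G) : IsBounded G := by
  obtain ⟨J, -, hb, -⟩ := hG
  exact hb

/-- For a Jordan domain `G` with null boundary, an exhausting sequence `{Gₙ}` of smoothly
bounded Jordan domains with conformal parametrizations `φₙ : 𝔻 → Gₙ` (extended to
homeomorphisms of the closures), and `γ ∈ B₂¹(ℂ∖cl(G))` whose boundary functions
`θ ↦ γ(φₙ(e^{iθ}))` are integrable with `sup_n ρ(γ∘φₙ) < ∞`, there is `g ∈ B₂(G)`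
whose Cauchy transform is `γ`. -/
theorem mem_range_cauchyTransform_of_rho_bounded (G : Set ℂ) (hG : IsJordanDomain G)
    (hbd : volume (frontier G) = 0)
    (Gs : ℕ → Set ℂ)
    (hGsJ : ∀ n, IsJordanDomain (Gs n))
    (hGsSm : ∀ n, IsSmoothJordanCurve (frontier (Gs n)))
    (hnest : ∀ n, closure (Gs (n + 1)) ⊆ Gs n)
    (hinter : (⋂ n, Gs n) = closure G)
    (φ : ℕ → ℂ → ℂ)
    (hφd : ∀ n, DifferentiableOn ℂ (φ n) (Metric.ball 0 1))
    (hφc : ∀ n, ContinuousOn (φ n) (Metric.closedBall 0 1))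
    (hφi : ∀ n, Set.InjOn (φ n) (Metric.closedBall 0 1))
    (hφim : ∀ n, φ n '' Metric.ball 0 1 = Gs n)
    (hφcl : ∀ n, φ n '' Metric.closedBall 0 1 = closure (Gs n))
    (γ : ℂ → ℂ) (hγ : MemB21 ((closure G)ᶜ) γ)
    (hint : ∀ n : ℕ,
      IntervalIntegrable (fun θ : ℝ => γ (φ n (Complex.exp (θ * Complex.I))))
        volume 0 (2 * Real.pi))
    (hsummable : ∀ n : ℕ,
      Summable (fun k : ℕ => ((k : ℝ) + 1) * ‖fourierCoef (γ ∘ φ n) (-((k : ℤ) + 1))‖ ^ 2))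
    (hsup : ∃ C : ℝ, ∀ n : ℕ,
      Real.pi * ∑' k : ℕ,
          ((k : ℝ) + 1) * ‖fourierCoef (γ ∘ φ n) (-((k : ℤ) + 1))‖ ^ 2 ≤ C) :
    ∃ g : ℂ → ℂ, MemB2 G g ∧ ∀ ζ ∉ closure G, γ ζ = cauchyTransform G g ζ := by
  obtain ⟨hγd, hγ0, -⟩ := hγ
  obtain ⟨C, hC⟩ := hsup
  refine exists_cauchyTransform_eq_of_norm_sum_le hG.isOpen hG.isBounded
    (C := Real.pi⁻¹ * √C) (norm_sum_mul_le_of_nested hbd (fun n => (hGsJ n).isOpen)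
      (fun n => (hGsJ n).isBounded) hnest hinter fun n s c hζ => ?_)
  have hK : closure G ⊆ φ n '' ball 0 1 := by
    rw [hφim n, ← hinter]
    exact iInter_subset _ n
  have h := norm_sum_mul_le_of_conformal isClosed_closure (hφd n) (hφc n) (hφi n) hK hγd hγ0
    (hsummable n) (hC n) s c (by rwa [hφcl n])
  rwa [hφim n, ← mul_assoc] at h
end

section
/- Let G' ⊂ ℂ be a bounded Jordan domain with smooth Jordan curve boundary ∂G', let φ be a conformal (biholomorphic) map of the unit disk 𝔻 onto G' extending to a homeomorphism of cl(𝔻) onto cl(G'), and let γ be holomorphic on ℂ∖G' with γ(∞) = 0 such that θ ↦ γ(φ(e^{iθ})) is integrable with ρ(γ∘φ) < ∞. Then for every function h holomorphic on an open neighborhood of cl(G'), |(1/2πi)∮_{∂G'} γ(ξ) h(ξ) dξ| ≤ (√2/π) · ρ(γ∘φ(e^{iθ})) · ‖h‖_{B₂(G')}. -/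
open Complex MeasureTheory Metric Set Filter Bornology

theorem fourierCoef_eq_fourierCoeffOn (f : ℂ → ℂ) (k : ℤ) :
    fourierCoef f k =
      fourierCoeffOn Real.two_pi_pos (fun θ : ℝ => f (Complex.exp (θ * Complex.I))) k := by
  rw [fourierCoeffOn_eq_integral, fourierCoef, sub_zero, Complex.real_smul]
  push_cast
  congr 1
  refine intervalIntegral.integral_congr fun θ _ => ?_
  simp only [fourier_coe_apply, smul_eq_mul]
  rw [mul_comm]
  congr 2
  have := Real.pi_ne_zero
  push_cast
  field_simp

theorem fourierCoef_comp_mul_left (f : ℂ → ℂ) {w : ℂ} (hw : ‖w‖ = 1) (k : ℤ) :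
    fourierCoef (fun z => f (w * z)) k = w ^ k * fourierCoef f k := by
  obtain ⟨α, rfl⟩ := (Complex.norm_eq_one_iff w).1 hw
  set G : ℝ → ℂ := fun θ => f (Complex.exp (θ * Complex.I)) *
    Complex.exp (-(Complex.I * (k : ℂ) * (θ : ℂ))) with hG
  have hper : Function.Periodic G (2 * Real.pi) := by
    intro θ
    have h1 : Complex.exp (((θ + 2 * Real.pi : ℝ) : ℂ) * Complex.I) =
        Complex.exp (θ * Complex.I) := by
      rw [← Complex.exp_periodic (θ * Complex.I)]
      congr 1; push_cast; ring
    have h2 : Complex.exp (-(Complex.I * (k : ℂ) * ((θ + 2 * Real.pi : ℝ) : ℂ))) =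
        Complex.exp (-(Complex.I * (k : ℂ) * (θ : ℂ))) := by
      rw [Complex.exp_eq_exp_iff_exists_int]
      exact ⟨-k, by push_cast; ring⟩
    simp only [hG, h1, h2]
  have h3 : ∀ θ : ℝ, f (Complex.exp (α * Complex.I) * Complex.exp (θ * Complex.I)) *
      Complex.exp (-(Complex.I * (k : ℂ) * (θ : ℂ))) =
      Complex.exp (α * Complex.I) ^ k * G (θ + α) := by
    intro θ
    have : Complex.exp (-(Complex.I * (k : ℂ) * (θ : ℂ))) = Complex.exp (α * Complex.I) ^ k *
        Complex.exp (-(Complex.I * (k : ℂ) * ((θ + α : ℝ) : ℂ))) := by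
      rw [← Complex.exp_int_mul, ← Complex.exp_add]
      congr 1; push_cast; ring
    rw [← Complex.exp_add, this, hG]
    simp only
    rw [show ((θ + α : ℝ) : ℂ) * Complex.I = α * Complex.I + θ * Complex.I by push_cast; ring]
    ring
  have h4 : ∫ θ in (0 : ℝ)..(2 * Real.pi), G (θ + α) = ∫ θ in (0 : ℝ)..(2 * Real.pi), G θ := by
    rw [intervalIntegral.integral_comp_add_right, zero_add, add_comm,
      hper.intervalIntegral_add_eq α 0,
      zero_add]
  simp only [fourierCoef, h3, intervalIntegral.integral_const_mul]
  rw [h4]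
  ring

theorem fourierCoef_eq_circleIntegral (F : ℂ → ℂ) {R : ℝ} (hR : R ≠ 0) (k : ℤ) :
    fourierCoef (fun z => F (R * z)) k =
      (R : ℂ) ^ k / (2 * Real.pi * Complex.I) * ∮ z in C(0, R), z ^ (-k - 1) * F z := by
  have hRc : (R : ℂ) ≠ 0 := by exact_mod_cast hR
  simp only [circleIntegral, fourierCoef, deriv_circleMap, circleMap, zero_add, smul_eq_mul]
  rw [← intervalIntegral.integral_const_mul, ← intervalIntegral.integral_const_mul]
  refine intervalIntegral.integral_congr fun θ _ => ?_
  have hE := Complex.exp_ne_zero (θ * Complex.I)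
  have h1 : Complex.exp (-(Complex.I * (k : ℂ) * (θ : ℂ))) =
      Complex.exp (θ * Complex.I) ^ (-k) := by
    rw [← Complex.exp_int_mul]
    congr 1; push_cast; ring
  rw [h1, zpow_sub₀ (mul_ne_zero hRc hE), zpow_one, mul_zpow, zpow_neg (R : ℂ)]
  have hpi : (Real.pi : ℂ) ≠ 0 := by exact_mod_cast Real.pi_ne_zero
  have hk : (R : ℂ) ^ k ≠ 0 := zpow_ne_zero _ hRc
  field_simp [Complex.I_ne_zero]

theorem fourierCoef_of_neg {F : ℂ → ℂ} (hF : DiffContOnCl ℂ F (ball 0 1)) {k : ℤ} (hk : k < 0) :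
    fourierCoef F k = 0 := by
  have h := fourierCoef_eq_circleIntegral F one_ne_zero k
  simp only [Complex.ofReal_one, one_mul] at h
  obtain ⟨m, hm⟩ := Int.eq_ofNat_of_zero_le (show 0 ≤ -k - 1 by omega)
  have hc : ContinuousOn F (closedBall 0 1) := by
    simpa [closure_ball (0 : ℂ) one_ne_zero] using hF.continuousOn
  rw [h, Complex.circleIntegral_eq_zero_of_differentiable_on_off_countable zero_le_one
    Set.countable_empty, mul_zero]
  · rw [hm]
    simp only [zpow_natCast]
    fun_prop
  · intro z hz
    rw [hm]
    have := hF.differentiableAt isOpen_ball hz.1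
    simp only [zpow_natCast]
    fun_prop

theorem fourierCoef_natCast {F : ℂ → ℂ} {R : ℝ} (hR : 0 < R)
    (hF : DiffContOnCl ℂ F (ball 0 R)) (n : ℕ) :
    fourierCoef (fun z => F (R * z)) n =
      (R : ℂ) ^ n * (iteratedDeriv n F 0 / (n.factorial : ℂ)) := by
  rw [fourierCoef_eq_circleIntegral F hR.ne']
  have h := hF.circleIntegral_one_div_sub_center_pow_smul hR n
  have : (∮ z in C(0, R), z ^ (-(n : ℤ) - 1) * F z) =
      ∮ z in C(0, R), (1 / (z - 0) ^ (n + 1)) • F z := by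
    congr 1
    ext z
    rw [smul_eq_mul, sub_zero, one_div, show (-(n : ℤ) - 1) = -((n + 1 : ℕ) : ℤ) by push_cast; ring,
      zpow_neg, zpow_natCast]
  rw [this, h, smul_eq_mul, zpow_natCast]
  have hpi : (Real.pi : ℂ) ≠ 0 := by exact_mod_cast Real.pi_ne_zero
  field_simp [Complex.I_ne_zero]

theorem sum_sq_le_integral_circle {g : ℂ → ℂ} (hg : DifferentiableOn ℂ g (ball 0 1)) {r : ℝ}
    (hr0 : 0 < r) (hr1 : r < 1) (N : ℕ) :
    2 * Real.pi * ∑ n ∈ Finset.range N,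
        r ^ (2 * n) * ‖iteratedDeriv n g 0 / (n.factorial : ℂ)‖ ^ 2 ≤
      ∫ θ in (-Real.pi)..Real.pi, ‖g (r * Complex.exp (θ * Complex.I))‖ ^ 2 := by
  have hmem : ∀ θ : ℝ, (r : ℂ) * Complex.exp (θ * Complex.I) ∈ ball (0 : ℂ) 1 := fun θ => by
    simpa [Complex.norm_exp_ofReal_mul_I, abs_of_pos hr0] using hr1
  have hcont : Continuous fun θ : ℝ => g (r * Complex.exp (θ * Complex.I)) :=
    hg.continuousOn.comp_continuous (by fun_prop) hmem
  have hsub : closedBall (0 : ℂ) r ⊆ ball 0 1 := closedBall_subset_ball hr1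
  have hF : DiffContOnCl ℂ g (ball 0 r) := (hg.mono hsub).diffContOnCl_ball subset_rfl
  have hL2 : MemLp (fun θ : ℝ => g (r * Complex.exp (θ * Complex.I))) 2
      (volume.restrict (Ioc 0 (2 * Real.pi))) :=
    (memLp_two_iff_integrable_sq_norm hcont.aestronglyMeasurable).2
      (((hcont.norm.pow 2).integrableOn_Icc).mono_set Ioc_subset_Icc_self)
  have hcoef : ∀ n : ℕ, ‖fourierCoeffOn Real.two_pi_pos
      (fun θ : ℝ => g (r * Complex.exp (θ * Complex.I))) n‖ ^ 2 =
      r ^ (2 * n) * ‖iteratedDeriv n g 0 / (n.factorial : ℂ)‖ ^ 2 := by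
    intro n
    rw [← fourierCoef_eq_fourierCoeffOn (fun z => g (r * z)), fourierCoef_natCast hr0 hF, norm_mul,
      mul_pow, norm_pow, Complex.norm_real, Real.norm_of_nonneg hr0.le, ← pow_mul, mul_comm n 2]
  have hsum := sum_le_hasSum ((Finset.range N).map Nat.castEmbedding)
    (fun i _ => by positivity) (hasSum_sq_fourierCoeffOn Real.two_pi_pos hL2)
  rw [Finset.sum_map] at hsum
  simp only [Nat.castEmbedding_apply, hcoef, sub_zero, smul_eq_mul] at hsum
  have hper : Function.Periodic (fun θ : ℝ => ‖g (r * Complex.exp (θ * Complex.I))‖ ^ 2)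
      (2 * Real.pi) := by
    intro θ
    have : Complex.exp (((θ + 2 * Real.pi : ℝ) : ℂ) * Complex.I) =
        Complex.exp (θ * Complex.I) := by
      rw [← Complex.exp_periodic (θ * Complex.I)]
      congr 1; push_cast; ring
    simp only [this]
  have hshift := hper.intervalIntegral_add_eq (-Real.pi) 0
  rw [show -Real.pi + 2 * Real.pi = Real.pi by ring, zero_add] at hshift
  rw [hshift]
  have hpi := Real.two_pi_pos
  rwa [inv_mul_eq_div, le_div_iff₀' hpi] at hsum

theorem sum_sq_le_integral_ball {g : ℂ → ℂ} (hg : DifferentiableOn ℂ g (ball 0 1))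
    (hint : IntegrableOn (fun z => ‖g z‖ ^ 2) (ball 0 1)) (N : ℕ) :
    Real.pi * ∑ n ∈ Finset.range N,
      ‖iteratedDeriv n g 0 / (n.factorial : ℂ)‖ ^ 2 / ((n : ℝ) + 1) ≤
      ∫ z in ball 0 1, ‖g z‖ ^ 2 := by
  set c : ℕ → ℝ := fun n => ‖iteratedDeriv n g 0 / (n.factorial : ℂ)‖ ^ 2 with hc
  have hc0 : ∀ n, 0 ≤ c n := fun n => by positivity
  have hpi := Real.pi_pos
  set G : ℂ → ENNReal := (ball (0 : ℂ) 1).indicator fun z => ENNReal.ofReal (‖g z‖ ^ 2) with hG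
  have hGm : Measurable G := by
    classical
    rw [hG, ← Set.piecewise_eq_indicator]
    refine ContinuousOn.measurable_piecewise ?_ continuousOn_const measurableSet_ball
    exact ENNReal.continuous_ofReal.comp_continuousOn (hg.continuousOn.norm.pow 2)
  have h1 : ENNReal.ofReal (∫ z in ball 0 1, ‖g z‖ ^ 2) = ∫⁻ z, G z := by
    rw [ofReal_integral_eq_lintegral_ofReal hint (ae_of_all _ fun z => by positivity),
      lintegral_indicator measurableSet_ball]
  set P : ℝ → ℝ := fun r => r * (2 * Real.pi * ∑ n ∈ Finset.range N, r ^ (2 * n) * c n) with hP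
  have hPc : Continuous P := by fun_prop
  have h2 : ∫ r in Ioo (0 : ℝ) 1, P r = Real.pi * ∑ n ∈ Finset.range N, c n / ((n : ℝ) + 1) := by
    rw [← integral_Ioc_eq_integral_Ioo, ← intervalIntegral.integral_of_le zero_le_one]
    have : ∀ r : ℝ, P r = ∑ n ∈ Finset.range N, (2 * Real.pi * c n) * r ^ (2 * n + 1) := by
      intro r
      simp only [hP, Finset.mul_sum]
      exact Finset.sum_congr rfl fun n _ => by ring
    simp only [this]
    rw [intervalIntegral.integral_finsetSum
      fun n _ => (by fun_prop : Continuous _).intervalIntegrable _ _, Finset.mul_sum]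
    refine Finset.sum_congr rfl fun n _ => ?_
    rw [intervalIntegral.integral_const_mul, integral_pow]
    push_cast
    field_simp
    ring
  have h3 : ENNReal.ofReal (∫ r in Ioo (0 : ℝ) 1, P r) ≤ ∫⁻ z, G z := by
    rw [← Complex.lintegral_comp_polarCoord_symm, polarCoord_target, Measure.volume_eq_prod,
      ← Measure.prod_restrict, lintegral_prod]
    · rw [ofReal_integral_eq_lintegral_ofReal
        ((hPc.integrableOn_Icc (a := 0) (b := 1)).mono_set Ioo_subset_Icc_self)]
      · refine le_trans (setLIntegral_mono' measurableSet_Ioo fun r hr => ?_)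
          (lintegral_mono_set Ioo_subset_Ioi_self)
        have hmem : ∀ θ : ℝ, (r : ℂ) * Complex.exp (θ * Complex.I) ∈ ball (0 : ℂ) 1 := fun θ => by
          simpa [Complex.norm_exp_ofReal_mul_I, abs_of_pos hr.1] using hr.2
        have hcont : Continuous fun θ : ℝ => g (r * Complex.exp (θ * Complex.I)) :=
          hg.continuousOn.comp_continuous (by fun_prop) hmem
        have hval : ∀ θ : ℝ, G (Complex.polarCoord.symm (r, θ)) =
            ENNReal.ofReal (‖g (r * Complex.exp (θ * Complex.I))‖ ^ 2) := by
          intro θ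
          have : Complex.polarCoord.symm (r, θ) = (r : ℂ) * Complex.exp (θ * Complex.I) := by
            rw [Complex.polarCoord_symm_apply, Complex.exp_mul_I]; simp
          rw [this, hG, Set.indicator_of_mem (hmem θ)]
        simp only [hval, smul_eq_mul]
        rw [lintegral_const_mul' _ _ ENNReal.ofReal_ne_top, ENNReal.ofReal_mul hr.1.le]
        gcongr
        have hci : IntegrableOn (fun θ : ℝ => ‖g (r * Complex.exp (θ * Complex.I))‖ ^ 2)
            (Ioo (-Real.pi) Real.pi) :=
          ((hcont.norm.pow 2).integrableOn_Icc).mono_set Ioo_subset_Icc_self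
        rw [← ofReal_integral_eq_lintegral_ofReal hci (ae_of_all _ fun z => by positivity)]
        refine ENNReal.ofReal_le_ofReal ?_
        rw [← integral_Ioc_eq_integral_Ioo, ← intervalIntegral.integral_of_le (by linarith)]
        exact sum_sq_le_integral_circle hg hr.1 hr.2 N
      · refine (ae_restrict_iff' measurableSet_Ioo).2 (ae_of_all _ fun r hr => ?_)
        have := hr.1
        have : 0 ≤ ∑ n ∈ Finset.range N, r ^ (2 * n) * c n :=
          Finset.sum_nonneg fun n _ => mul_nonneg (by positivity) (hc0 n)
        simp only [hP, Pi.zero_apply]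
        positivity
    · refine Measurable.aemeasurable ?_
      refine Measurable.smul (ENNReal.measurable_ofReal.comp measurable_fst) (hGm.comp ?_)
      have : ⇑Complex.polarCoord.symm =
          fun p : ℝ × ℝ => (p.1 : ℂ) * (Real.cos p.2 + Real.sin p.2 * Complex.I) := by
        ext p; rw [Complex.polarCoord_symm_apply]
      rw [this]
      fun_prop
  rw [← h1, h2] at h3
  exact (ENNReal.ofReal_le_ofReal_iff (integral_nonneg fun z => by positivity)).1 h3

theorem norm_integral_zpow_mul_of_apply_zero_eq_one {ψ l : ℝ → ℂ} {F : ℂ → ℂ}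
    (hψ : Continuous ψ) (hψ1 : ∀ θ, ‖ψ θ‖ = 1) (hinj : InjOn ψ (Ico 0 (2 * Real.pi)))
    (hsurj : ∀ w : ℂ, ‖w‖ = 1 → ∃ θ ∈ Ico 0 (2 * Real.pi), ψ θ = w)
    (h0 : ψ 0 = 1) (h2π : ψ (2 * Real.pi) = 1)
    (hl : Continuous l) (hF : ContinuousOn F (sphere 0 1))
    (hd : ∀ θ, HasDerivAt (fun t => F (ψ t)) (l θ) θ) (k : ℤ) :
    ‖∫ θ in (0 : ℝ)..(2 * Real.pi), ψ θ ^ k * l θ‖ =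
      2 * Real.pi * (|k| * ‖fourierCoef F (-k)‖) := by
  have hpi := Real.pi_pos
  have h2pi := Real.two_pi_pos
  set I₀ : Set ℝ := Ioo 0 (2 * Real.pi) with hI₀
  set τ : ℝ → ℝ := fun θ => Complex.arg (-ψ θ) + Real.pi with hτ
  have hexpτ : ∀ θ, Complex.exp (τ θ * Complex.I) = ψ θ := by
    intro θ
    have h := Complex.norm_mul_exp_arg_mul_I (-ψ θ)
    rw [norm_neg, hψ1, Complex.ofReal_one, one_mul] at h
    simp only [hτ]
    rw [Complex.ofReal_add, add_mul, Complex.exp_add, h, Complex.exp_pi_mul_I]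
    ring
  have hne : ∀ θ ∈ I₀, ψ θ ≠ 1 := fun θ hθ h => by
    have := hinj ⟨hθ.1.le, hθ.2⟩ ⟨le_rfl, h2pi⟩ (h.trans h0.symm)
    exact hθ.1.ne' this
  have hslit : ∀ θ ∈ I₀, -ψ θ ∈ Complex.slitPlane := by
    intro θ hθ
    rw [Complex.mem_slitPlane_iff_arg]
    refine ⟨fun h => hne θ hθ ?_, ?_⟩
    · rw [← hexpτ θ, hτ]
      simp only [h]
      rw [← Complex.exp_two_pi_mul_I]
      congr 1; push_cast; ring
    · rw [neg_ne_zero, ← norm_ne_zero_iff, hψ1]; exact one_ne_zero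
  have hτmem : ∀ θ ∈ I₀, τ θ ∈ I₀ := by
    intro θ hθ
    have h1 := Complex.neg_pi_lt_arg (-ψ θ)
    have h2 := (Complex.arg_le_pi (-ψ θ)).lt_of_ne (Complex.mem_slitPlane_iff_arg.1 (hslit θ hθ)).1
    constructor <;> simp only [hτ] <;> linarith
  have hτc : ContinuousOn τ I₀ := fun θ hθ =>
    ((ContinuousAt.comp (f := fun t => -ψ t) (Complex.continuousAt_arg (hslit θ hθ))
      hψ.neg.continuousAt).add continuousAt_const).continuousWithinAt
  have hτi : InjOn τ I₀ := fun a ha b hb hab => by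
    refine hinj ⟨ha.1.le, ha.2⟩ ⟨hb.1.le, hb.2⟩ ?_
    rw [← hexpτ, ← hexpτ, hab]
  have hτm : Measurable τ := (Complex.measurable_arg.comp hψ.neg.measurable).add_const _
  have hσ : ∀ s ∈ I₀, ∃ θ ∈ I₀, τ θ = s := by
    intro s hs
    obtain ⟨θ, hθ, hθs⟩ := hsurj (Complex.exp (s * Complex.I)) (Complex.norm_exp_ofReal_mul_I s)
    have h1 : τ θ = s := by
      have : -ψ θ = ((1 : ℝ) : ℂ) * Complex.exp ((s - Real.pi : ℝ) * Complex.I) := by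
        rw [hθs, Complex.ofReal_sub, sub_mul, Complex.exp_sub, Complex.exp_pi_mul_I]
        simp [div_neg]
      simp only [hτ]
      rw [this, Complex.exp_mul_I, Complex.arg_mul_cos_add_sin_mul_I one_pos
        ⟨by linarith [hs.1], by linarith [hs.2]⟩]
      ring
    refine ⟨θ, ⟨hθ.1.lt_of_ne fun h => ?_, hθ.2⟩, h1⟩
    have : τ 0 = 2 * Real.pi := by simp only [hτ, h0, Complex.arg_neg_one]; ring
    rw [← h, this] at h1
    exact hs.2.ne' h1
  choose! σ hσmem hσ using hσ
  have hint : ∀ a b : ℝ, ∫ θ in a..b, l θ = F (ψ b) - F (ψ a) := fun a b =>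
    intervalIntegral.integral_eq_sub_of_hasDerivAt (fun θ _ => hd θ) (hl.intervalIntegrable _ _)
  have hψσ : ∀ s ∈ I₀, ψ (σ s) = Complex.exp (s * Complex.I) := fun s hs => by
    rw [← hexpτ, hσ s hs]
  -- Integral of `l` over the part of the parameter interval mapped beyond the angle `s`.
  have hinner : ∃ ε : ℂ, ‖ε‖ = 1 ∧ ∀ s ∈ I₀,
      ∫ θ in I₀, (if s < τ θ then l θ else 0) =
        ε * (F (Complex.exp (s * Complex.I)) - F 1) := by
    have hite : ∀ s, (fun θ => if s < τ θ then l θ else 0) = {θ | s < τ θ}.indicator l := by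
      intro s; ext θ; simp [Set.indicator_apply]
    have hms : ∀ s, MeasurableSet {θ | s < τ θ} := fun s => measurableSet_lt measurable_const hτm
    rcases ContinuousOn.strictMonoOn_of_injOn_Ioo h2pi hτc hτi with hm | hm
    · refine ⟨-1, by simp, fun s hs => ?_⟩
      have hset : I₀ ∩ {θ | s < τ θ} = Ioo (σ s) (2 * Real.pi) := by
        ext θ
        constructor
        · rintro ⟨h1, h2⟩
          refine ⟨?_, h1.2⟩
          rw [Set.mem_ofPred_eq, ← hσ s hs] at h2
          exact (hm.lt_iff_lt (hσmem s hs) h1).1 h2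
        · rintro ⟨h1, h2⟩
          have h3 : θ ∈ I₀ := ⟨(hσmem s hs).1.trans h1, h2⟩
          exact ⟨h3, by rw [Set.mem_ofPred_eq, ← hσ s hs]; exact hm (hσmem s hs) h3 h1⟩
      rw [hite, setIntegral_indicator (hms s), hset, ← integral_Ioc_eq_integral_Ioo,
        ← intervalIntegral.integral_of_le (hσmem s hs).2.le, hint, h2π, hψσ s hs]
      ring
    · refine ⟨1, by simp, fun s hs => ?_⟩
      have hset : I₀ ∩ {θ | s < τ θ} = Ioo 0 (σ s) := by
        ext θ
        constructor
        · rintro ⟨h1, h2⟩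
          refine ⟨h1.1, ?_⟩
          rw [Set.mem_ofPred_eq, ← hσ s hs] at h2
          exact (hm.lt_iff_gt (hσmem s hs) h1).1 h2
        · rintro ⟨h1, h2⟩
          have h3 : θ ∈ I₀ := ⟨h1, h2.trans (hσmem s hs).2⟩
          exact ⟨h3, by rw [Set.mem_ofPred_eq, ← hσ s hs]; exact hm h3 (hσmem s hs) h2⟩
      rw [hite, setIntegral_indicator (hms s), hset, ← integral_Ioc_eq_integral_Ioo,
        ← intervalIntegral.integral_of_le (hσmem s hs).1.le, hint, h0, hψσ s hs]
      ring
  obtain ⟨ε, hε, hinner⟩ := hinner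
  set e : ℝ → ℂ := fun s => Complex.I * k * Complex.exp (Complex.I * k * s) with he
  have hec : Continuous e := by fun_prop
  have heint : ∀ a : ℝ, ∫ s in (0 : ℝ)..a, e s = Complex.exp (Complex.I * k * a) - 1 := by
    intro a
    have := intervalIntegral.integral_eq_sub_of_hasDerivAt (a := 0) (b := a)
      (f := fun s : ℝ => Complex.exp (Complex.I * k * s)) (f' := e) (fun s _ => by
        have h1 : HasDerivAt (fun s : ℝ => Complex.I * k * (s : ℂ)) (Complex.I * k) s := by
          simpa using (Complex.ofRealCLM.hasDerivAt (x := s)).const_mul (Complex.I * k)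
        simpa [he, mul_comm] using h1.cexp) (hec.intervalIntegrable _ _)
    rw [this]; simp
  have hψk : ∀ θ, ψ θ ^ k = Complex.exp (Complex.I * k * τ θ) := fun θ => by
    rw [← hexpτ, ← Complex.exp_int_mul]; congr 1; ring
  have hstep : ∀ θ ∈ I₀, ψ θ ^ k - 1 = ∫ s in I₀, if s < τ θ then e s else 0 := by
    intro θ hθ
    have hite : (fun s => if s < τ θ then e s else 0) = (Iio (τ θ)).indicator e := by
      ext s; simp [Set.indicator_apply]
    have hset : I₀ ∩ Iio (τ θ) = Ioo 0 (τ θ) := by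
      ext s
      exact ⟨fun h => ⟨h.1.1, h.2⟩, fun h => ⟨⟨h.1, h.2.trans (hτmem θ hθ).2⟩, h.2⟩⟩
    rw [hite, setIntegral_indicator measurableSet_Iio, hset, ← integral_Ioc_eq_integral_Ioo,
      ← intervalIntegral.integral_of_le (hτmem θ hθ).1.le, heint, hψk]
  have hconv : ∀ f : ℝ → ℂ, ∫ θ in (0 : ℝ)..(2 * Real.pi), f θ = ∫ θ in I₀, f θ := fun f => by
    rw [intervalIntegral.integral_of_le h2pi.le, integral_Ioc_eq_integral_Ioo]
  have hl0 : ∫ θ in (0 : ℝ)..(2 * Real.pi), l θ = 0 := by rw [hint, h0, h2π, sub_self]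
  have he0 : ∫ s in (0 : ℝ)..(2 * Real.pi), e s = 0 := by
    rw [heint, sub_eq_zero, Complex.exp_eq_one_iff]
    exact ⟨k, by push_cast; ring⟩
  have hψkc : Continuous fun θ => ψ θ ^ k := hψ.zpow₀ k fun θ => Or.inl <| by
    rw [← norm_ne_zero_iff, hψ1]; exact one_ne_zero
  have hprod : Integrable (Function.uncurry fun θ s => if s < τ θ then e s * l θ else 0)
      ((volume.restrict I₀).prod (volume.restrict I₀)) := by
    have hbase : Integrable (fun p : ℝ × ℝ => e p.2 * l p.1)
        ((volume.restrict I₀).prod (volume.restrict I₀)) := by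
      rw [Measure.prod_restrict, ← Measure.volume_eq_prod]
      refine IntegrableOn.mono_set (t := Icc 0 (2 * Real.pi) ×ˢ Icc 0 (2 * Real.pi)) ?_
        (prod_mono Ioo_subset_Icc_self Ioo_subset_Icc_self)
      exact ContinuousOn.integrableOn_compact (isCompact_Icc.prod isCompact_Icc)
        (by fun_prop)
    have : (Function.uncurry fun θ s => if s < τ θ then e s * l θ else 0) =
        {p : ℝ × ℝ | p.2 < τ p.1}.indicator fun p => e p.2 * l p.1 := by
      ext p; simp [Set.indicator_apply, Function.uncurry]
    rw [this]
    exact hbase.indicator (measurableSet_lt measurable_snd (hτm.comp measurable_fst))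
  have hmain : ∫ θ in (0 : ℝ)..(2 * Real.pi), ψ θ ^ k * l θ =
      ε * (Complex.I * k) * (2 * Real.pi * fourierCoef F (-k)) := by
    calc ∫ θ in (0 : ℝ)..(2 * Real.pi), ψ θ ^ k * l θ
        = ∫ θ in (0 : ℝ)..(2 * Real.pi), (ψ θ ^ k - 1) * l θ := by
          simp only [sub_mul, one_mul]
          rw [intervalIntegral.integral_sub
            ((by fun_prop : Continuous fun θ => ψ θ ^ k * l θ).intervalIntegrable _ _)
            (hl.intervalIntegrable _ _), hl0, sub_zero]
      _ = ∫ θ in I₀, ∫ s in I₀, if s < τ θ then e s * l θ else 0 := by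
          rw [hconv]
          refine setIntegral_congr_fun measurableSet_Ioo fun θ hθ => ?_
          rw [hstep θ hθ, ← integral_mul_const]
          simp only [ite_mul, zero_mul]
      _ = ∫ s in I₀, ∫ θ in I₀, if s < τ θ then e s * l θ else 0 := integral_integral_swap hprod
      _ = ∫ s in I₀, (ε * (e s * F (Complex.exp (s * Complex.I))) - ε * F 1 * e s) := by
          refine setIntegral_congr_fun measurableSet_Ioo fun s hs => ?_
          have : ∀ θ, (if s < τ θ then e s * l θ else 0) =
              e s * (if s < τ θ then l θ else 0) := fun θ => by split_ifs <;> simp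
          simp only [this]
          rw [integral_const_mul, hinner s hs]
          ring
      _ = ε * ∫ s in (0 : ℝ)..(2 * Real.pi), e s * F (Complex.exp (s * Complex.I)) := by
          have hFc : Continuous fun s : ℝ => F (Complex.exp (s * Complex.I)) :=
            hF.comp_continuous (by fun_prop) fun s => by simp
          have hFe : Continuous fun s : ℝ => e s * F (Complex.exp (s * Complex.I)) := hec.mul hFc
          rw [← hconv, intervalIntegral.integral_sub
            ((hFe.intervalIntegrable _ _).const_mul ε)
            ((hec.intervalIntegrable _ _).const_mul _),
            intervalIntegral.integral_const_mul, intervalIntegral.integral_const_mul, he0]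
          ring
      _ = ε * (Complex.I * k) * (2 * Real.pi * fourierCoef F (-k)) := by
          rw [fourierCoef, ← mul_assoc (2 * (Real.pi : ℂ)), mul_one_div_cancel (by simp),
            one_mul, mul_assoc ε, ← intervalIntegral.integral_const_mul (Complex.I * k)]
          congr 1
          refine intervalIntegral.integral_congr fun s _ => ?_
          simp only [he]
          rw [show -(Complex.I * ((-k : ℤ) : ℂ) * (s : ℂ)) = Complex.I * k * s by push_cast; ring]
          ring
  rw [hmain]
  simp only [norm_mul, hε, Complex.norm_I, Complex.norm_intCast, Complex.norm_real, one_mul,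
    Real.norm_of_nonneg hpi.le, Complex.norm_ofNat]
  push_cast
  ring

theorem norm_integral_zpow_mul {ψ l : ℝ → ℂ} {F : ℂ → ℂ}
    (hψ : Continuous ψ) (hψ1 : ∀ θ, ‖ψ θ‖ = 1) (hinj : InjOn ψ (Ico 0 (2 * Real.pi)))
    (hsurj : ∀ w : ℂ, ‖w‖ = 1 → ∃ θ ∈ Ico 0 (2 * Real.pi), ψ θ = w)
    (hper : ψ (2 * Real.pi) = ψ 0)
    (hl : Continuous l) (hF : ContinuousOn F (sphere 0 1))
    (hd : ∀ θ, HasDerivAt (fun t => F (ψ t)) (l θ) θ) (k : ℤ) :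
    ‖∫ θ in (0 : ℝ)..(2 * Real.pi), ψ θ ^ k * l θ‖ =
      2 * Real.pi * (|k| * ‖fourierCoef F (-k)‖) := by
  have hw : ‖ψ 0‖ = 1 := hψ1 0
  have hw0 : ψ 0 ≠ 0 := by rw [← norm_ne_zero_iff, hw]; exact one_ne_zero
  have h := norm_integral_zpow_mul_of_apply_zero_eq_one
    (ψ := fun θ => (ψ 0)⁻¹ * ψ θ) (l := l) (F := fun z => F (ψ 0 * z)) (by fun_prop)
    (fun θ => by simp [hψ1])
    (fun a ha b hb hab => hinj ha hb (mul_left_cancel₀ (inv_ne_zero hw0) hab))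
    (fun w hw' => by
      obtain ⟨θ, hθ, h⟩ := hsurj (ψ 0 * w) (by simp [hw, hw'])
      exact ⟨θ, hθ, by simp [h, hw0]⟩) (by simp [hw0]) (by simp [hper, hw0]) hl
    (hF.comp (by fun_prop) fun z hz => by simpa [hw] using hz)
    (fun θ => by simpa [mul_inv_cancel_left₀ hw0] using hd θ) k
  rw [fourierCoef_comp_mul_left F hw, norm_mul, norm_zpow, hw, one_zpow, one_mul] at h
  rw [← h]
  simp only [mul_zpow, mul_assoc]
  rw [intervalIntegral.integral_const_mul, norm_mul, norm_zpow, norm_inv, hw, inv_one, one_zpow,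
    one_mul]

theorem norm_integral_comp_mul_le_tsum {ψ l : ℝ → ℂ} {f : ℂ → ℂ}
    (hψ : Continuous ψ) (hψ1 : ∀ θ, ‖ψ θ‖ = 1) (hl : Continuous l)
    (hf : ContinuousOn f (sphere 0 1))
    (hs : Summable fun k : ℤ =>
      ‖fourierCoef f k‖ * ‖∫ θ in (0 : ℝ)..(2 * Real.pi), ψ θ ^ k * l θ‖) :
    ‖∫ θ in (0 : ℝ)..(2 * Real.pi), f (ψ θ) * l θ‖ ≤
      ∑' k : ℤ, ‖fourierCoef f k‖ * ‖∫ θ in (0 : ℝ)..(2 * Real.pi), ψ θ ^ k * l θ‖ := by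
  have : Fact (0 < 2 * Real.pi) := ⟨Real.two_pi_pos⟩
  have h2pi := Real.two_pi_pos
  -- The averages of the rotated integrands, whose Fourier series is absolutely convergent.
  have hfc : Continuous fun p : AddCircle (2 * Real.pi) × ℝ =>
      f ((AddCircle.toCircle p.1 : ℂ) * ψ p.2) * l p.2 := by
    refine (hf.comp_continuous ?_ fun p => ?_).mul (by fun_prop)
    · exact (continuous_subtype_val.comp (AddCircle.continuous_toCircle.comp continuous_fst)).mul
        (hψ.comp continuous_snd)
    · rw [mem_sphere_zero_iff_norm, norm_mul, hψ1, Circle.norm_coe, one_mul]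
  let A : C(AddCircle (2 * Real.pi), ℂ) :=
    ⟨fun t => ∫ θ in (0 : ℝ)..(2 * Real.pi), f ((AddCircle.toCircle t : ℂ) * ψ θ) * l θ,
      intervalIntegral.continuous_parametric_intervalIntegral_of_continuous' hfc _ _⟩
  have hexp : ∀ t : ℝ, ((AddCircle.toCircle (t : AddCircle (2 * Real.pi)) : Circle) : ℂ) =
      Complex.exp (t * Complex.I) := fun t => by
    rw [AddCircle.toCircle_apply_mk, div_self h2pi.ne', one_mul, Circle.coe_exp]
  have hcoef : ∀ k : ℤ, fourierCoeff A k =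
      fourierCoef f k * ∫ θ in (0 : ℝ)..(2 * Real.pi), ψ θ ^ k * l θ := by
    intro k
    set E : ℝ → ℂ := fun t => Complex.exp (-(Complex.I * (k : ℂ) * (t : ℂ))) with hE
    have hEc : Continuous E := by fun_prop
    have hfourier : ∀ t : ℝ, fourier (-k) (t : AddCircle (2 * Real.pi)) = E t := fun t => by
      rw [fourier_coe_apply]
      congr 1
      have := Real.pi_ne_zero
      push_cast
      field_simp
    have hcont : Continuous fun p : ℝ × ℝ =>
        E p.1 * (f (Complex.exp (p.1 * Complex.I) * ψ p.2) * l p.2) := by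
      refine (hEc.comp continuous_fst).mul ((hf.comp_continuous (by fun_prop) fun p => ?_).mul
        (by fun_prop))
      simp [hψ1]
    have hrot : ∀ θ, (1 / (2 * Real.pi) : ℂ) * ∫ t in (0 : ℝ)..(2 * Real.pi),
        E t * f (Complex.exp (t * Complex.I) * ψ θ) = ψ θ ^ k * fourierCoef f k := fun θ => by
      rw [← fourierCoef_comp_mul_left f (hψ1 θ), fourierCoef]
      congr 1
      refine intervalIntegral.integral_congr fun t _ => ?_
      simp only [hE]
      rw [mul_comm (Complex.exp (t * Complex.I)) (ψ θ), mul_comm]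
    rw [fourierCoeff_eq_intervalIntegral _ _ 0, zero_add, Complex.real_smul]
    simp only [hfourier, smul_eq_mul, A, ContinuousMap.coe_mk, hexp]
    simp only [← intervalIntegral.integral_const_mul (E _)]
    have hintOn : IntegrableOn
        (Function.uncurry fun t θ => E t * (f (Complex.exp (t * Complex.I) * ψ θ) * l θ))
        (uIoc 0 (2 * Real.pi) ×ˢ uIoc 0 (2 * Real.pi)) :=
      (ContinuousOn.integrableOn_compact (isCompact_uIcc.prod isCompact_uIcc)
        hcont.continuousOn).mono_set (prod_mono uIoc_subset_uIcc uIoc_subset_uIcc)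
    rw [intervalIntegral_intervalIntegral_swap hintOn]
    simp only [← mul_assoc (E _), intervalIntegral.integral_mul_const]
    push_cast
    rw [← intervalIntegral.integral_const_mul, ← intervalIntegral.integral_const_mul]
    refine intervalIntegral.integral_congr fun θ _ => ?_
    rw [← mul_assoc, hrot]
    ring
  have hs' : Summable fun k => ‖fourierCoeff A k‖ := by
    simpa only [hcoef, norm_mul] using hs
  have h := has_pointwise_sum_fourier_series_of_summable hs'.of_norm 0
  simp only [fourier_eval_zero, smul_eq_mul, mul_one] at h
  have hA0 : A 0 = ∫ θ in (0 : ℝ)..(2 * Real.pi), f (ψ θ) * l θ := by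
    simp [A, AddCircle.toCircle_zero]
  rw [← hA0, ← h.tsum_eq]
  simpa only [hcoef, norm_mul] using norm_tsum_le_tsum_norm hs'

theorem summable_and_tsum_mul_sq_fourierCoef_le {F : ℂ → ℂ} (hF : DiffContOnCl ℂ F (ball 0 1))
    (hint : IntegrableOn (fun z => ‖deriv F z‖ ^ 2) (ball 0 1)) :
    (Summable fun n : ℕ => ((n : ℝ) + 1) * ‖fourierCoef F (n + 1)‖ ^ 2) ∧
      Real.pi * ∑' n : ℕ, ((n : ℝ) + 1) * ‖fourierCoef F (n + 1)‖ ^ 2 ≤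
        ∫ z in ball 0 1, ‖deriv F z‖ ^ 2 := by
  have hcoef : ∀ n : ℕ, ((n : ℝ) + 1) * ‖fourierCoef F (n + 1)‖ ^ 2 =
      ‖iteratedDeriv n (deriv F) 0 / (n.factorial : ℂ)‖ ^ 2 / ((n : ℝ) + 1) := by
    intro n
    have h := fourierCoef_natCast one_pos hF (n + 1)
    simp only [Complex.ofReal_one, one_mul, one_pow] at h
    have hn : ((n : ℝ) + 1) ≠ 0 := by positivity
    have hn' : ‖(n : ℂ) + 1‖ = (n : ℝ) + 1 := by
      rw [← Nat.cast_add_one, Complex.norm_natCast]; push_cast; ring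
    push_cast at h
    rw [h, iteratedDeriv_succ', Nat.factorial_succ]
    push_cast
    rw [norm_div, norm_div, norm_mul, hn']
    field_simp
  have hle : ∀ N, ∑ n ∈ Finset.range N, ((n : ℝ) + 1) * ‖fourierCoef F (n + 1)‖ ^ 2 ≤
      (∫ z in ball 0 1, ‖deriv F z‖ ^ 2) / Real.pi := by
    intro N
    rw [le_div_iff₀' Real.pi_pos]
    simpa only [hcoef] using sum_sq_le_integral_ball (hF.1.deriv isOpen_ball) hint N
  have hpos : ∀ n : ℕ, 0 ≤ ((n : ℝ) + 1) * ‖fourierCoef F (n + 1)‖ ^ 2 := fun n => by positivity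
  exact ⟨summable_of_sum_range_le hpos hle,
    (le_div_iff₀' Real.pi_pos).1 (Real.tsum_le_of_sum_range_le hpos hle)⟩

/-- Cauchy–Schwarz for the duality pairing of the Dirichlet-type semi-norms. -/
theorem norm_integral_comp_mul_le {ψ l : ℝ → ℂ} {f F : ℂ → ℂ}
    (hψ : Continuous ψ) (hψ1 : ∀ θ, ‖ψ θ‖ = 1) (hinj : InjOn ψ (Ico 0 (2 * Real.pi)))
    (hsurj : ∀ w : ℂ, ‖w‖ = 1 → ∃ θ ∈ Ico 0 (2 * Real.pi), ψ θ = w)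
    (hper : ψ (2 * Real.pi) = ψ 0) (hl : Continuous l)
    (hf : ContinuousOn f (sphere 0 1)) (hF : DiffContOnCl ℂ F (ball 0 1))
    (hd : ∀ θ, HasDerivAt (fun t => F (ψ t)) (l θ) θ)
    (hfs : Summable fun n : ℕ => ((n : ℝ) + 1) * ‖fourierCoef f (-((n : ℤ) + 1))‖ ^ 2)
    (hFs : Summable fun n : ℕ => ((n : ℝ) + 1) * ‖fourierCoef F (n + 1)‖ ^ 2) :
    ‖∫ θ in (0 : ℝ)..(2 * Real.pi), f (ψ θ) * l θ‖ ≤ 2 * Real.pi *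
      (√(∑' n : ℕ, ((n : ℝ) + 1) * ‖fourierCoef f (-((n : ℤ) + 1))‖ ^ 2) *
        √(∑' n : ℕ, ((n : ℝ) + 1) * ‖fourierCoef F (n + 1)‖ ^ 2)) := by
  have hFc : ContinuousOn F (sphere 0 1) :=
    hF.2.mono (by rw [closure_ball 0 one_ne_zero]; exact sphere_subset_closedBall)
  have hterm := norm_integral_zpow_mul hψ hψ1 hinj hsurj hper hl hFc hd
  set a : ℤ → ℝ := fun k => ‖fourierCoef f k‖ * ‖∫ θ in (0 : ℝ)..(2 * Real.pi), ψ θ ^ k * l θ‖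
    with ha
  let i : ℕ → ℤ := fun n => -((n : ℤ) + 1)
  have hi : Function.Injective i := fun m n h => by simp only [i] at h; omega
  have hsupp : ∀ k ∉ range i, a k = 0 := by
    intro k hk
    have hk0 : 0 ≤ k := by
      by_contra! h
      exact hk ⟨(-k - 1).toNat, by simp only [i]; omega⟩
    simp only [ha, hterm]
    rcases hk0.eq_or_lt with rfl | h
    · simp
    · rw [fourierCoef_of_neg hF (by omega : -k < 0)]; simp
  set u : ℕ → ℝ := fun n => √((n : ℝ) + 1) * ‖fourierCoef f (-((n : ℤ) + 1))‖ with hu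
  set v : ℕ → ℝ := fun n => √((n : ℝ) + 1) * ‖fourierCoef F (n + 1)‖ with hv
  have hu2 : ∀ n, u n ^ (2 : ℝ) = ((n : ℝ) + 1) * ‖fourierCoef f (-((n : ℤ) + 1))‖ ^ 2 :=
      fun n => by
    rw [Real.rpow_two, hu, mul_pow, Real.sq_sqrt (by positivity)]
  have hv2 : ∀ n, v n ^ (2 : ℝ) = ((n : ℝ) + 1) * ‖fourierCoef F (n + 1)‖ ^ 2 := fun n => by
    rw [Real.rpow_two, hv, mul_pow, Real.sq_sqrt (by positivity)]
  have hai : ∀ n, a (i n) = 2 * Real.pi * (u n * v n) := by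
    intro n
    simp only [ha, hterm, i, hu, hv, neg_neg, abs_neg]
    rw [abs_of_nonneg (by positivity : (0 : ℤ) ≤ (n : ℤ) + 1)]
    have := Real.mul_self_sqrt (by positivity : (0 : ℝ) ≤ (n : ℝ) + 1)
    push_cast
    linear_combination
      (-2 * Real.pi * ‖fourierCoef f (-((n : ℤ) + 1))‖ * ‖fourierCoef F (n + 1)‖) * this
  obtain ⟨hs, hle⟩ := Real.summable_and_inner_le_Lp_mul_Lq_tsum_of_nonneg
    (Real.HolderConjugate.two_two) (f := u) (g := v) (fun n => by positivity)
    (fun n => by positivity) (by simpa only [hu2] using hfs) (by simpa only [hv2] using hFs)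
  have hcomp : a ∘ i = fun n => 2 * Real.pi * (u n * v n) := funext hai
  have hsum : Summable a := (hi.summable_iff hsupp).1 (hcomp ▸ hs.mul_left _)
  refine (norm_integral_comp_mul_le_tsum hψ hψ1 hl hf hsum).trans ?_
  rw [← hi.tsum_eq (f := a) (fun k hk => by by_contra h; exact hk (hsupp k h))]
  simp only [hai]
  rw [tsum_mul_left]
  simp only [hu2, hv2, ← Real.sqrt_eq_rpow] at hle
  gcongr

/-- A primitive of `(h ∘ φ) φ'` on the disc extends continuously to the closed disc, where it is
locally of the form `H ∘ φ` for a primitive `H` of `h`. -/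
theorem exists_continuousOn_primitive {φ h : ℂ → ℂ} {U : Set ℂ}
    (hφd : DifferentiableOn ℂ φ (ball 0 1)) (hφc : ContinuousOn φ (closedBall 0 1))
    (hU : IsOpen U) (hφU : MapsTo φ (closedBall 0 1) U) (hh : DifferentiableOn ℂ h U) :
    ∃ F : ℂ → ℂ, ContinuousOn F (closedBall 0 1) ∧
      (∀ z ∈ ball (0 : ℂ) 1, HasDerivAt F (h (φ z) * deriv φ z) z) ∧
      ∀ w ∈ closedBall (0 : ℂ) 1, ∃ H : ℂ → ℂ, HasDerivAt H (h (φ w)) (φ w) ∧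
        ∀ᶠ z in nhdsWithin w (closedBall 0 1), F z = H (φ z) := by
  have hbc : ball (0 : ℂ) 1 ⊆ closedBall 0 1 := ball_subset_closedBall
  have hcl : closedBall (0 : ℂ) 1 ⊆ closure (ball 0 1) := (closure_ball 0 one_ne_zero).ge
  obtain ⟨F₀, hF₀⟩ : Complex.IsExactOn (fun z => h (φ z) * deriv φ z) (ball 0 1) :=
    DifferentiableOn.isExactOn_ball <|
      (hh.comp hφd fun z hz => hφU (hbc hz)).mul (hφd.deriv isOpen_ball)
  have hloc : ∀ w ∈ closedBall (0 : ℂ) 1, ∃ H : ℂ → ℂ, ∃ δ > 0, HasDerivAt H (h (φ w)) (φ w) ∧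
      ContinuousOn (fun z => H (φ z)) (closedBall 0 1 ∩ ball w δ) ∧
      ∀ z ∈ ball 0 1 ∩ ball w δ, F₀ z = H (φ z) := by
    intro w hw
    obtain ⟨ε, hε, hεU⟩ := Metric.isOpen_iff.1 hU _ (hφU hw)
    obtain ⟨H, hH⟩ := (hh.mono hεU).isExactOn_ball
    obtain ⟨δ, hδ, hδε⟩ := Metric.continuousOn_iff.1 hφc w hw ε hε
    have hmaps : MapsTo φ (closedBall 0 1 ∩ ball w δ) (ball (φ w) ε) :=
      fun z hz => hδε z hz.1 hz.2
    have hopen : IsOpen (ball 0 1 ∩ ball w δ) := isOpen_ball.inter isOpen_ball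
    have hd : ∀ z ∈ ball 0 1 ∩ ball w δ, HasDerivAt (fun z => F₀ z - H (φ z)) 0 z := by
      intro z hz
      have h1 := hH _ (hmaps ⟨hbc hz.1, hz.2⟩)
      have h2 := (hφd.differentiableAt (isOpen_ball.mem_nhds hz.1)).hasDerivAt
      exact ((hF₀ z hz.1).sub (h1.comp z h2)).congr_deriv (sub_self _)
    obtain ⟨c, hc⟩ := hopen.exists_is_const_of_deriv_eq_zero
      ((convex_ball _ _).inter (convex_ball _ _)).isPreconnected
      (fun z hz => (hd z hz).differentiableAt.differentiableWithinAt)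
      (fun z hz => (hd z hz).deriv)
    refine ⟨fun ξ => H ξ + c, δ, hδ, (hH _ (mem_ball_self hε)).add_const c, ?_, fun z hz => ?_⟩
    · have hHc : ContinuousOn H (ball (φ w) ε) :=
        fun ξ hξ => (hH ξ hξ).continuousAt.continuousWithinAt
      exact (hHc.comp (hφc.mono inter_subset_left) hmaps).add continuousOn_const
    · rw [← hc z hz]; ring
  have hlim : ∀ w ∈ closedBall (0 : ℂ) 1, ∀ (H : ℂ → ℂ) (δ : ℝ),
      ContinuousOn (fun z => H (φ z)) (closedBall 0 1 ∩ ball w δ) →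
      (∀ z ∈ ball 0 1 ∩ ball w δ, F₀ z = H (φ z)) → ∀ z ∈ closedBall 0 1 ∩ ball w δ,
        Tendsto F₀ (nhdsWithin z (ball 0 1)) (nhds (H (φ z))) := by
    intro w _ H δ hc he z hz
    have hn : ball w δ ∈ nhds z := isOpen_ball.mem_nhds hz.2
    rw [← nhdsWithin_inter_of_mem' (mem_nhdsWithin_of_mem_nhds hn)]
    refine ((hc z hz).mono_left (nhdsWithin_mono _ (inter_subset_inter_left _ hbc))).congr' ?_
    filter_upwards [self_mem_nhdsWithin] with x hx using (he x hx).symm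
  have hF₀c : ContinuousOn F₀ (ball 0 1) := fun z hz => (hF₀ z hz).continuousAt.continuousWithinAt
  refine ⟨extendFrom (ball 0 1) F₀, continuousOn_extendFrom hcl fun w hw => ?_, fun z hz => ?_,
    fun w hw => ?_⟩
  · obtain ⟨H, δ, hδ, -, hc, he⟩ := hloc w hw
    exact ⟨_, hlim w hw H δ hc he w ⟨hw, mem_ball_self hδ⟩⟩
  · refine (hF₀ z hz).congr_of_eventuallyEq ?_
    filter_upwards [isOpen_ball.mem_nhds hz] with x hx using extendFrom_extends hF₀c x hx
  · obtain ⟨H, δ, hδ, hH, hc, he⟩ := hloc w hw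
    refine ⟨H, hH, ?_⟩
    filter_upwards [self_mem_nhdsWithin, mem_nhdsWithin_of_mem_nhds (ball_mem_nhds w hδ)]
      with z hz hz' using extendFrom_eq (hcl hz) (hlim w hw H δ hc he z ⟨hz, hz'⟩)

theorem image_sphere_eq_frontier {φ : ℂ → ℂ} {G : Set ℂ} (hG : IsOpen G)
    (hφi : InjOn φ (closedBall 0 1)) (hφim : φ '' ball 0 1 = G)
    (hφcl : φ '' closedBall 0 1 = closure G) : φ '' sphere 0 1 = frontier G := by
  rw [hG.frontier_eq, ← hφcl, ← hφim, ← closedBall_sdiff_ball,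
    hφi.image_sdiff_subset ball_subset_closedBall]

/-- The pull-back of a parametrization of the boundary by a homeomorphism of the closed disc. -/
theorem exists_circle_parametrization {φ : ℂ → ℂ} {q : ℝ → ℂ}
    (hφc : ContinuousOn φ (closedBall 0 1)) (hφi : InjOn φ (closedBall 0 1))
    (hq : Continuous q) (hqper : ∀ θ : ℝ, q (θ + 2 * Real.pi) = q θ)
    (hqinj : InjOn q (Ico 0 (2 * Real.pi))) (hqrange : range q = φ '' sphere 0 1) :
    ∃ ψ : ℝ → ℂ, Continuous ψ ∧ (∀ θ, ‖ψ θ‖ = 1) ∧ (∀ θ, φ (ψ θ) = q θ) ∧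
      InjOn ψ (Ico 0 (2 * Real.pi)) ∧
      (∀ w : ℂ, ‖w‖ = 1 → ∃ θ ∈ Ico 0 (2 * Real.pi), ψ θ = w) ∧ ψ (2 * Real.pi) = ψ 0 := by
  have hsub : sphere (0 : ℂ) 1 ⊆ closedBall 0 1 := sphere_subset_closedBall
  have hφs := hφi.mono hsub
  choose ψ hψs hψ using fun θ => (hqrange ▸ mem_range_self θ : q θ ∈ φ '' sphere 0 1)
  have huniq : ∀ {θ : ℝ} {w : ℂ}, w ∈ sphere (0 : ℂ) 1 → φ w = q θ → ψ θ = w :=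
    fun {θ w} hw h => hφs (hψs θ) hw ((hψ θ).trans h.symm)
  refine ⟨ψ, ?_, fun θ => by simpa using hψs θ, hψ, fun a ha b hb hab => ?_, fun w hw => ?_, ?_⟩
  · rw [continuous_iff_isClosed]
    intro s hs
    have : ψ ⁻¹' s = q ⁻¹' (φ '' (sphere 0 1 ∩ s)) := by
      ext θ
      refine ⟨fun h => ⟨ψ θ, ⟨hψs θ, h⟩, hψ θ⟩, ?_⟩
      rintro ⟨w, ⟨hw, hws⟩, h⟩
      rwa [mem_preimage, huniq hw h]
    rw [this]
    exact (((isCompact_sphere 0 1).inter_right hs).image_of_continuousOn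
      (hφc.mono (inter_subset_left.trans hsub))).isClosed.preimage hq
  · exact hqinj ha hb (by rw [← hψ, ← hψ, hab])
  · have hw' : w ∈ sphere (0 : ℂ) 1 := by simpa using hw
    obtain ⟨θ, hθ⟩ : φ w ∈ range q := hqrange ▸ mem_image_of_mem φ hw'
    obtain ⟨t, ht, htθ⟩ := (show Function.Periodic q (2 * Real.pi) from hqper).exists_mem_Ico₀
      Real.two_pi_pos θ
    exact ⟨t, ht, huniq hw' (hθ.symm.trans htθ)⟩
  · exact huniq (hψs 0) (by rw [hψ, ← hqper 0, zero_add])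

theorem abs_det_toSpanSingleton (a : ℂ) :
    |((ContinuousLinearMap.toSpanSingleton ℂ a).restrictScalars ℝ).det| = ‖a‖ ^ 2 := by
  simp [ContinuousLinearMap.det, LinearMap.det_restrictScalars, Algebra.norm_complex_eq,
    Complex.normSq_eq_norm_sq]

theorem setIntegral_comp_mul_deriv {φ h : ℂ → ℂ} {V G : Set ℂ} (hV : IsOpen V)
    (hφd : DifferentiableOn ℂ φ V) (hφi : InjOn φ V) (hφim : φ '' V = G) :
    ∫ z in V, ‖h (φ z) * deriv φ z‖ ^ 2 = ∫ z in G, ‖h z‖ ^ 2 := by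
  rw [← hφim, integral_image_eq_integral_abs_det_fderiv_smul volume hV.measurableSet
    (f' := fun z => (ContinuousLinearMap.toSpanSingleton ℂ (deriv φ z)).restrictScalars ℝ)
    (fun z hz => ((hφd.differentiableAt (hV.mem_nhds hz)).hasDerivAt.hasFDerivAt.restrictScalars
      ℝ).hasFDerivWithinAt) hφi]
  refine setIntegral_congr_fun hV.measurableSet fun z _ => ?_
  simp only [abs_det_toSpanSingleton, smul_eq_mul, norm_mul, mul_pow]
  ring

theorem integrableOn_comp_mul_deriv {φ h : ℂ → ℂ} {V G : Set ℂ} (hV : IsOpen V)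
    (hφd : DifferentiableOn ℂ φ V) (hφi : InjOn φ V) (hφim : φ '' V = G)
    (hh : IntegrableOn (fun z => ‖h z‖ ^ 2) G) :
    IntegrableOn (fun z => ‖h (φ z) * deriv φ z‖ ^ 2) V := by
  rw [← hφim, integrableOn_image_iff_integrableOn_abs_det_fderiv_smul volume hV.measurableSet
    (f' := fun z => (ContinuousLinearMap.toSpanSingleton ℂ (deriv φ z)).restrictScalars ℝ)
    (fun z hz => ((hφd.differentiableAt (hV.mem_nhds hz)).hasDerivAt.hasFDerivAt.restrictScalars
      ℝ).hasFDerivWithinAt) hφi] at hh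
  refine hh.congr_fun (fun z _ => ?_) hV.measurableSet
  simp only [abs_det_toSpanSingleton, smul_eq_mul, norm_mul, mul_pow]
  ring

/-- For a smoothly bounded Jordan domain `G'` (with positively oriented `C¹`
parametrization `q` of `∂G'`), a conformal map `φ : 𝔻 → G'` extending to a homeomorphism
of the closures, and `γ` holomorphic outside `G'` vanishing at infinity with
`ρ(γ∘φ) < ∞`, every `h` holomorphic on a neighborhood of `cl(G')` satisfies
`|(1/2πi) ∮_{∂G'} γ(ξ)h(ξ) dξ| ≤ (√2/π) ρ(γ∘φ) ‖h‖_{B₂(G')}`. -/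
theorem boundary_functional_bound (G' : Set ℂ) (hG' : IsJordanDomain G')
    (q : ℝ → ℂ) (hq1 : ContDiff ℝ 1 q)
    (hqper : ∀ θ : ℝ, q (θ + 2 * Real.pi) = q θ)
    (hqinj : Set.InjOn q (Set.Ico 0 (2 * Real.pi)))
    (hq' : ∀ θ : ℝ, deriv q θ ≠ 0)
    (hqrange : Set.range q = frontier G')
    (hqorient : ∀ z ∈ G',
      (1 / (2 * Real.pi * Complex.I)) *
        (∫ θ in (0:ℝ)..(2 * Real.pi), deriv q θ / (q θ - z)) = 1)
    (φ : ℂ → ℂ)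
    (hφd : DifferentiableOn ℂ φ (Metric.ball 0 1))
    (hφc : ContinuousOn φ (Metric.closedBall 0 1))
    (hφi : Set.InjOn φ (Metric.closedBall 0 1))
    (hφim : φ '' Metric.ball 0 1 = G')
    (hφcl : φ '' Metric.closedBall 0 1 = closure G')
    (γ : ℂ → ℂ) (hγd : DifferentiableOn ℂ γ G'ᶜ)
    (hγ0 : Tendsto γ (cobounded ℂ) (nhds 0))
    (hint : IntervalIntegrable (fun θ : ℝ => γ (φ (Complex.exp (θ * Complex.I))))
      volume 0 (2 * Real.pi))
    (hrho : Summable (fun k : ℕ =>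
      ((k : ℝ) + 1) * ‖fourierCoef (γ ∘ φ) (-((k : ℤ) + 1))‖ ^ 2))
    (U : Set ℂ) (hU : IsOpen U) (hUG : closure G' ⊆ U)
    (h : ℂ → ℂ) (hh : DifferentiableOn ℂ h U) :
    ‖(1 / (2 * Real.pi * Complex.I)) *
        ∫ θ in (0:ℝ)..(2 * Real.pi), γ (q θ) * h (q θ) * deriv q θ‖ ≤
      (Real.sqrt 2 / Real.pi) *
        Real.sqrt (Real.pi * ∑' k : ℕ,
          ((k : ℝ) + 1) * ‖fourierCoef (γ ∘ φ) (-((k : ℤ) + 1))‖ ^ 2) *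
        Real.sqrt (∫ z in G', ‖h z‖ ^ 2 ∂volume) := by
  have hbc : ball (0 : ℂ) 1 ⊆ closedBall 0 1 := ball_subset_closedBall
  have hGo := hG'.isOpen
  have hbd : IsBounded G' := by obtain ⟨J, -, hb, -⟩ := hG'; exact hb
  have hφU : MapsTo φ (closedBall 0 1) U := fun z hz =>
    hUG (hφcl ▸ mem_image_of_mem φ hz)
  have hsph := image_sphere_eq_frontier hGo hφi hφim hφcl
  obtain ⟨ψ, hψ, hψ1, hφψ, hinj, hsurj, hper⟩ := exists_circle_parametrization hφc hφi
    hq1.continuous hqper hqinj (hqrange.trans hsph.symm)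
  obtain ⟨F, hFc, hFd, hFloc⟩ := exists_continuousOn_primitive hφd hφc hU hφU hh
  have hF : DiffContOnCl ℂ F (ball 0 1) :=
    ⟨fun z hz => (hFd z hz).differentiableAt.differentiableWithinAt,
      by rwa [closure_ball 0 one_ne_zero]⟩
  have hfr : ∀ z ∈ sphere (0 : ℂ) 1, φ z ∈ G'ᶜ := fun z hz hz' => by
    have : φ z ∈ frontier G' := hsph ▸ mem_image_of_mem φ hz
    exact (hGo.frontier_eq ▸ this).2 hz'
  have hf : ContinuousOn (γ ∘ φ) (sphere 0 1) :=
    hγd.continuousOn.comp (hφc.mono sphere_subset_closedBall) hfr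
  have hψc : ∀ θ, ψ θ ∈ closedBall (0 : ℂ) 1 := fun θ => by simp [hψ1]
  have hl : Continuous fun θ => h (q θ) * deriv q θ :=
    (hh.continuousOn.comp_continuous hq1.continuous fun θ => hφψ θ ▸ hφU (hψc θ)).mul
      (hq1.continuous_deriv le_rfl)
  have hd : ∀ θ, HasDerivAt (fun t => F (ψ t)) (h (q θ) * deriv q θ) θ := by
    intro θ
    obtain ⟨H, hH, he⟩ := hFloc _ (hψc θ)
    rw [hφψ] at hH
    refine HasDerivAt.congr_of_eventuallyEq
      (hH.comp_of_eq θ ((hq1.differentiable one_ne_zero) θ).hasDerivAt rfl) ?_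
    have ht : Tendsto ψ (nhds θ) (nhdsWithin (ψ θ) (closedBall 0 1)) :=
      tendsto_nhdsWithin_iff.2 ⟨hψ.tendsto θ, Eventually.of_forall hψc⟩
    filter_upwards [ht.eventually he] with t ht
    rw [ht, hφψ]; rfl
  have hhG : IntegrableOn (fun z => ‖h z‖ ^ 2) G' :=
    (ContinuousOn.integrableOn_compact hbd.isCompact_closure
      ((hh.continuousOn.mono hUG).norm.pow 2)).mono_set subset_closure
  have hcongr : ∀ z ∈ ball (0 : ℂ) 1, ‖h (φ z) * deriv φ z‖ ^ 2 = ‖deriv F z‖ ^ 2 := fun z hz => by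
    rw [(hFd z hz).deriv]
  obtain ⟨hFs, hFle⟩ := summable_and_tsum_mul_sq_fourierCoef_le hF
    ((integrableOn_comp_mul_deriv isOpen_ball hφd (hφi.mono hbc) hφim hhG).congr_fun hcongr
      measurableSet_ball)
  rw [← setIntegral_congr_fun measurableSet_ball hcongr,
    setIntegral_comp_mul_deriv isOpen_ball hφd (hφi.mono hbc) hφim] at hFle
  have key := norm_integral_comp_mul_le hψ hψ1 hinj hsurj hper hl hf hF hd hrho hFs
  have hI : ∫ θ in (0:ℝ)..(2 * Real.pi), γ (q θ) * h (q θ) * deriv q θ =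
      ∫ θ in (0:ℝ)..(2 * Real.pi), (γ ∘ φ) (ψ θ) * (h (q θ) * deriv q θ) := by
    simp only [Function.comp_apply, hφψ, mul_assoc]
  rw [hI, norm_mul]
  set S := ∑' k : ℕ, ((k : ℝ) + 1) * ‖fourierCoef (γ ∘ φ) (-((k : ℤ) + 1))‖ ^ 2
  set T := ∑' n : ℕ, ((n : ℝ) + 1) * ‖fourierCoef F (n + 1)‖ ^ 2
  have hpi := Real.pi_pos
  have hnorm : ‖(1 / (2 * Real.pi * Complex.I) : ℂ)‖ = 1 / (2 * Real.pi) := by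
    simp [abs_of_pos hpi]
  calc _ ≤ 1 / (2 * Real.pi) * (2 * Real.pi * (√S * √T)) := by rw [hnorm]; gcongr
    _ = 1 / Real.pi * (√(Real.pi * S) * √(Real.pi * T)) := by
      rw [Real.sqrt_mul hpi.le, Real.sqrt_mul hpi.le]
      field_simp
      rw [Real.sq_sqrt hpi.le]
      ring
    _ ≤ √2 / Real.pi * (√(Real.pi * S) * √(∫ z in G', ‖h z‖ ^ 2)) := by
      have : (1 : ℝ) ≤ √2 := Real.one_le_sqrt.2 one_le_two
      gcongr
    _ = _ := by ring
end
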